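/- Let 0 < p_out < 1/2, let α : ℕ → (0,1), and let φ : ℕ → ℕ satisfy φ(N) ≤ N, φ(N)/log N → ∞, and log(1/α(N))/φ(N) → 0 as N → ∞. Consider, for each N, Bernoulli site percolation in which every vertex of the box {0,…,N−1}² is independently open with probability p_out (the pure-noise null hypothesis). Then there exist a constant C₂ = C₂(p_out) > 0 and N₀ ∈ ℕ such that for all N ≥ N₀, the probability that the box {0,…,N−1}² contains a connected set (in 𝕋²) of at least φ(N) open vertices is at most min{α(N), e^{−C₂·φ(N)}}. (This is the false-detection part of the main theorem: under the null hypothesis the detection algorithm reports an object with probability at most min{α(N), e^{−C₂·φ(N)}}.) -/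

import Mathlib

open MeasureTheory

abbrev Site := ℤ × ℤ
abbrev Config := Site → Bool

def triAdj (u v : Site) : Prop :=
  u - v ∈ ({(1, 0), (-1, 0), (0, 1), (0, -1), (1, 1), (-1, -1)} : Set Site)

def IsSitePercolation (q : Site → ℝ) (μ : Measure Config) : Prop :=
  IsProbabilityMeasure μ ∧
  ∀ (S : Finset Site) (f : Site → Bool),
    μ {ω | ∀ v ∈ S, ω v = f v} =
      ∏ v ∈ S, if f v then ENNReal.ofReal (q v) else ENNReal.ofReal (1 - q v)

def IsBernoulliPercolation (p : ℝ) (μ : Measure Config) : Prop :=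
  IsSitePercolation (fun _ => p) μ

def IsOpenPath (ω : Config) (l : List Site) : Prop :=
  l ≠ [] ∧ l.Chain' triAdj ∧ ∀ v ∈ l, ω v = true

def openCluster (ω : Config) (v : Site) : Set Site :=
  {w | ∃ l : List Site, IsOpenPath ω l ∧ l.head? = some v ∧ l.getLast? = some w}

/-- The `N × N` screen `{0, …, N−1}²`. -/
def screen (N : ℕ) : Set Site :=
  {v | 0 ≤ v.1 ∧ v.1 < N ∧ 0 ≤ v.2 ∧ v.2 < N}

/-- The box `[0, n]² = {0, …, n} × {0, …, n}`. -/
def box (n : ℕ) : Set Site :=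
  {v | 0 ≤ v.1 ∧ v.1 ≤ n ∧ 0 ≤ v.2 ∧ v.2 ≤ n}

/-- `S` is connected with respect to the triangular-lattice adjacency: any two
of its sites are joined by a path staying inside `S`. -/
def ConnectedIn (S : Set Site) : Prop :=
  ∀ u ∈ S, ∀ w ∈ S, ∃ l : List Site, l.head? = some u ∧ l.getLast? = some w ∧
    l.Chain' triAdj ∧ ∀ v ∈ l, v ∈ S

/-- The event `F_N(n)`: the screen `{0, …, N−1}²` contains a connected set of at
least `n` open sites. -/
def ClusterEvent (N n : ℕ) : Set Config :=
  {ω | ∃ S : Finset Site, ↑S ⊆ screen N ∧ n ≤ S.card ∧ ConnectedIn ↑S ∧ ∀ v ∈ S, ω v = true}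

/-- `l` is a left–right crossing of the box `[0, n]²` all of whose sites carry
the colour `b` (`true` = open/black, `false` = closed/white). -/
def IsLRCrossing (n : ℕ) (b : Bool) (ω : Config) (l : List Site) : Prop :=
  l.Chain' triAdj ∧ (∀ v ∈ l, v ∈ box n ∧ ω v = b) ∧
  (∃ u, l.head? = some u ∧ u.1 = 0) ∧ (∃ w, l.getLast? = some w ∧ w.1 = n)

/-- `l` is a top–bottom crossing of the box `[0, n]²` all of whose sites carry
the colour `b`. -/
def IsTBCrossing (n : ℕ) (b : Bool) (ω : Config) (l : List Site) : Prop :=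
  l.Chain' triAdj ∧ (∀ v ∈ l, v ∈ box n ∧ ω v = b) ∧
  (∃ u, l.head? = some u ∧ u.2 = n) ∧ (∃ w, l.getLast? = some w ∧ w.2 = 0)

/-- The event `A_n`: there is an open left–right crossing of the box `[0, n]²`. -/
def EventA (n : ℕ) : Set Config := {ω | ∃ l, IsLRCrossing n true ω l}

/-- The event `B_n`: there is a closed top–bottom crossing of the box `[0, n]²`. -/
def EventB (n : ℕ) : Set Config := {ω | ∃ l, IsTBCrossing n false ω l}

/-- There exist `k` pairwise vertex-disjoint open left–right crossings of `[0, n]²`. -/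
def HasDisjointCrossings (n : ℕ) (ω : Config) (k : ℕ) : Prop :=
  ∃ L : Fin k → List Site, (∀ i, IsLRCrossing n true ω (L i)) ∧
    ∀ i j, i ≠ j → ∀ v, v ∈ L i → v ∉ L j

/-- The critical probability for site percolation on the triangular lattice:
the supremum of those `p ∈ [0,1]` for which the open cluster of the origin is
almost surely finite. -/
noncomputable def pcSite : ℝ :=
  sSup {p : ℝ | p ∈ Set.Icc (0 : ℝ) 1 ∧
    ∀ μ : Measure Config, IsBernoulliPercolation p μ →
      μ {ω | (openCluster ω (0, 0)).Infinite} = 0}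

/-! ### Finite Bernoulli product expectations -/

section BernoulliExpectation

open Classical in
/-- The real-valued indicator of a proposition. -/
noncomputable def ind (P : Prop) : ℝ := if P then 1 else 0

lemma ind_of {P : Prop} (h : P) : ind P = 1 := if_pos h

lemma ind_of_not {P : Prop} (h : ¬ P) : ind P = 0 := if_neg h

lemma ind_nonneg (P : Prop) : 0 ≤ ind P := by
  unfold ind; split_ifs <;> norm_num

lemma ind_le_one (P : Prop) : ind P ≤ 1 := by
  unfold ind; split_ifs <;> norm_num

lemma ind_mono {P Q : Prop} (h : P → Q) : ind P ≤ ind Q := by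
  by_cases hP : P
  · rw [ind_of hP, ind_of (h hP)]
  · rw [ind_of_not hP]; exact ind_nonneg Q

variable {V : Type*} [DecidableEq V]

/-- The expectation of `f` evaluated at the random set that contains each element of `Λ`
independently with probability `p`. -/
noncomputable def bexp (p : ℝ) (Λ : Finset V) (f : Finset V → ℝ) : ℝ :=
  ∑ ω ∈ Λ.powerset, p ^ ω.card * (1 - p) ^ (Λ \ ω).card * f ω

/-- The probability that the random set that contains each element of `Λ` independently with
probability `p` satisfies `P`. -/
noncomputable def bprob (p : ℝ) (Λ : Finset V) (P : Finset V → Prop) : ℝ :=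
  bexp p Λ fun ω => ind (P ω)

lemma bexp_empty (p : ℝ) (f : Finset V → ℝ) : bexp p ∅ f = f ∅ := by
  simp [bexp]

lemma bexp_insert (p : ℝ) {x : V} {Λ : Finset V} (hx : x ∉ Λ) (f : Finset V → ℝ) :
    bexp p (insert x Λ) f =
      p * bexp p Λ (fun ω => f (insert x ω)) + (1 - p) * bexp p Λ f := by
  unfold bexp
  rw [Finset.sum_powerset_insert hx, add_comm, Finset.mul_sum, Finset.mul_sum]
  congr 1
  · refine Finset.sum_congr rfl fun ω hω => ?_
    have hxω : x ∉ ω := fun h => hx (Finset.mem_powerset.1 hω h)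
    have h2 : insert x Λ \ insert x ω = Λ \ ω := by
      ext y; simp only [Finset.mem_sdiff, Finset.mem_insert]
      constructor
      · rintro ⟨h | h, h'⟩ <;> tauto
      · rintro ⟨h, h'⟩
        refine ⟨Or.inr h, ?_⟩
        rintro (rfl | h3)
        · exact hx h
        · exact h' h3
    rw [Finset.card_insert_of_notMem hxω, h2]; ring
  · refine Finset.sum_congr rfl fun ω hω => ?_
    have hxω : x ∉ ω := fun h => hx (Finset.mem_powerset.1 hω h)
    rw [Finset.insert_sdiff_of_notMem _ hxω,
      Finset.card_insert_of_notMem (fun h => hx (Finset.mem_sdiff.1 h).1)]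
    ring

lemma bexp_congr (p : ℝ) {Λ : Finset V} {f g : Finset V → ℝ} (h : ∀ ω ⊆ Λ, f ω = g ω) :
    bexp p Λ f = bexp p Λ g :=
  Finset.sum_congr rfl fun ω hω => by rw [h ω (Finset.mem_powerset.1 hω)]

lemma bexp_add (p : ℝ) (Λ : Finset V) (f g : Finset V → ℝ) :
    bexp p Λ (fun ω => f ω + g ω) = bexp p Λ f + bexp p Λ g := by
  simp only [bexp, mul_add, Finset.sum_add_distrib]

lemma bexp_sub (p : ℝ) (Λ : Finset V) (f g : Finset V → ℝ) :
    bexp p Λ (fun ω => f ω - g ω) = bexp p Λ f - bexp p Λ g := by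
  simp only [bexp, mul_sub, Finset.sum_sub_distrib]

lemma bexp_const_mul (p : ℝ) (Λ : Finset V) (c : ℝ) (f : Finset V → ℝ) :
    bexp p Λ (fun ω => c * f ω) = c * bexp p Λ f := by
  simp only [bexp, Finset.mul_sum]
  exact Finset.sum_congr rfl fun ω _ => by ring

lemma bexp_sum {ι : Type*} (p : ℝ) (Λ : Finset V) (I : Finset ι) (f : ι → Finset V → ℝ) :
    bexp p Λ (fun ω => ∑ i ∈ I, f i ω) = ∑ i ∈ I, bexp p Λ (f i) := by
  simp only [bexp, Finset.mul_sum]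
  exact Finset.sum_comm

lemma bexp_const (p : ℝ) (Λ : Finset V) (c : ℝ) : bexp p Λ (fun _ => c) = c := by
  induction Λ using Finset.induction_on with
  | empty => rw [bexp_empty]
  | insert x Λ hx ih => rw [bexp_insert p hx, ih]; ring

lemma bexp_mono {p : ℝ} (hp0 : 0 ≤ p) (hp1 : p ≤ 1) {Λ : Finset V} {f g : Finset V → ℝ}
    (h : ∀ ω ⊆ Λ, f ω ≤ g ω) : bexp p Λ f ≤ bexp p Λ g :=
  Finset.sum_le_sum fun ω hω => by
    have := h ω (Finset.mem_powerset.1 hω)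
    have h1 : 0 ≤ 1 - p := by linarith
    gcongr

lemma bexp_nonneg {p : ℝ} (hp0 : 0 ≤ p) (hp1 : p ≤ 1) {Λ : Finset V} {f : Finset V → ℝ}
    (h : ∀ ω ⊆ Λ, 0 ≤ f ω) : 0 ≤ bexp p Λ f := by
  have := bexp_mono hp0 hp1 h
  rwa [bexp_const] at this

/-- Each single configuration contributes at most the whole expectation. -/
lemma weight_mul_le_bexp {p : ℝ} (hp0 : 0 ≤ p) (hp1 : p ≤ 1) {Λ η : Finset V} (hη : η ⊆ Λ)
    {f : Finset V → ℝ} (h : ∀ ω ⊆ Λ, 0 ≤ f ω) :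
    p ^ η.card * (1 - p) ^ (Λ \ η).card * f η ≤ bexp p Λ f := by
  refine Finset.single_le_sum (f := fun ω => p ^ ω.card * (1 - p) ^ (Λ \ ω).card * f ω)
    (fun ω hω => ?_) (Finset.mem_powerset.2 hη)
  have := h ω (Finset.mem_powerset.1 hω)
  have h1 : 0 ≤ 1 - p := by linarith
  positivity

/-- Fubini for a disjoint union. -/
lemma bexp_union (p : ℝ) {A B : Finset V} (hAB : Disjoint A B) (f : Finset V → ℝ) :
    bexp p (A ∪ B) f = bexp p A fun ω => bexp p B fun η => f (ω ∪ η) := by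
  induction A using Finset.induction_on generalizing f with
  | empty => simp [bexp_empty]
  | insert x A hx ih =>
    rw [Finset.disjoint_insert_left] at hAB
    have hx' : x ∉ A ∪ B := by simp [hx, hAB.1]
    rw [Finset.insert_union, bexp_insert p hx', bexp_insert p hx, ih hAB.2, ih hAB.2]
    simp only [Finset.insert_union]

lemma bexp_local (p : ℝ) {A Λ : Finset V} (hA : A ⊆ Λ) {f : Finset V → ℝ}
    (hf : ∀ ω, f ω = f (ω ∩ A)) : bexp p Λ f = bexp p A f := by
  conv_lhs => rw [← Finset.union_sdiff_of_subset hA]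
  rw [bexp_union p Finset.disjoint_sdiff]
  refine bexp_congr p fun ω hω => ?_
  rw [← bexp_const p (Λ \ A) (f ω)]
  refine bexp_congr p fun η hη => ?_
  rw [hf (ω ∪ η), hf ω]
  congr 1
  ext y
  have := @hη y
  simp only [Finset.mem_inter, Finset.mem_union, Finset.mem_sdiff] at *
  tauto

lemma bexp_mul_of_disjoint (p : ℝ) {A B Λ : Finset V} (hA : A ⊆ Λ) (hB : B ⊆ Λ)
    (hAB : Disjoint A B) {f g : Finset V → ℝ} (hf : ∀ ω, f ω = f (ω ∩ A))
    (hg : ∀ ω, g ω = g (ω ∩ B)) :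
    bexp p Λ (fun ω => f ω * g ω) = bexp p A f * bexp p B g := by
  rw [bexp_local p (Finset.union_subset hA hB), bexp_union p hAB, mul_comm,
    ← bexp_const_mul]
  · refine bexp_congr p fun ω hω => ?_
    rw [mul_comm, ← bexp_const_mul]
    refine bexp_congr p fun η hη => ?_
    congr 1
    · rw [hf, hf ω, Finset.union_inter_distrib_right,
        Finset.disjoint_iff_inter_eq_empty.1 (Finset.disjoint_of_subset_left hη hAB.symm),
        Finset.union_empty]
    · rw [hg, hg η, Finset.union_inter_distrib_right,
        Finset.disjoint_iff_inter_eq_empty.1 (Finset.disjoint_of_subset_left hω hAB),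
        Finset.empty_union]
  · intro ω
    rw [hf ω, hg ω, hf (ω ∩ (A ∪ B)), hg (ω ∩ (A ∪ B)), Finset.inter_assoc, Finset.inter_assoc,
      Finset.inter_eq_right.2 Finset.subset_union_left,
      Finset.inter_eq_right.2 Finset.subset_union_right]

lemma bexp_map {W : Type*} [DecidableEq W] (p : ℝ) (Λ : Finset V) (e : V ≃ W)
    (f : Finset W → ℝ) :
    bexp p (Λ.map e.toEmbedding) f = bexp p Λ fun ω => f (ω.map e.toEmbedding) := by
  induction Λ using Finset.induction_on generalizing f with
  | empty => simp [bexp_empty]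
  | insert x Λ hx ih =>
    have hx' : e x ∉ Λ.map e.toEmbedding := by simpa using hx
    rw [bexp_insert p hx, Finset.map_insert, Equiv.coe_toEmbedding, bexp_insert p hx', ih, ih]
    simp only [Finset.map_insert, Equiv.coe_toEmbedding]

lemma bexp_compl (p : ℝ) (Λ : Finset V) (f : Finset V → ℝ) :
    bexp p Λ (fun ω => f (Λ \ ω)) = bexp (1 - p) Λ f := by
  unfold bexp
  refine Finset.sum_nbij' (fun ω => Λ \ ω) (fun ω => Λ \ ω) ?_ ?_ ?_ ?_ ?_
  · simp
  · simp
  · intro ω hω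
    simpa using Finset.mem_powerset.1 hω
  · intro ω hω
    simpa using Finset.mem_powerset.1 hω
  · intro ω hω
    rw [Finset.sdiff_sdiff_eq_self (Finset.mem_powerset.1 hω)]
    ring

/-- Harris's inequality. -/
lemma bexp_mul_le_bexp_mul {p : ℝ} (hp0 : 0 ≤ p) (hp1 : p ≤ 1) (Λ : Finset V)
    {f g : Finset V → ℝ} (hf : Monotone f) (hg : Monotone g) :
    bexp p Λ f * bexp p Λ g ≤ bexp p Λ fun ω => f ω * g ω := by
  induction Λ using Finset.induction_on generalizing f g with
  | empty => simp [bexp_empty]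
  | insert x Λ hx ih =>
    have hins : Monotone fun ω : Finset V => insert x ω := fun a b h =>
      Finset.insert_subset_insert x h
    have h1 := ih (hf.comp hins) (hg.comp hins)
    have h0 := ih hf hg
    have hf' : bexp p Λ f ≤ bexp p Λ (f ∘ fun ω => insert x ω) :=
      bexp_mono hp0 hp1 fun ω _ => hf (Finset.subset_insert x ω)
    have hg' : bexp p Λ g ≤ bexp p Λ (g ∘ fun ω => insert x ω) :=
      bexp_mono hp0 hp1 fun ω _ => hg (Finset.subset_insert x ω)
    rw [bexp_insert p hx, bexp_insert p hx, bexp_insert p hx]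
    simp only [Function.comp_def] at h1 hf' hg'
    have := mul_nonneg (mul_nonneg hp0 (sub_nonneg.2 hp1))
      (mul_nonneg (sub_nonneg.2 hf') (sub_nonneg.2 hg'))
    have h1' := mul_le_mul_of_nonneg_left h1 hp0
    have h0' := mul_le_mul_of_nonneg_left h0 (sub_nonneg.2 hp1)
    nlinarith

lemma bexp_le_bexp_of_le {p q : ℝ} (hp0 : 0 ≤ p) (hpq : p ≤ q) (hq1 : q ≤ 1) (Λ : Finset V)
    {f : Finset V → ℝ} (hf : Monotone f) : bexp p Λ f ≤ bexp q Λ f := by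
  induction Λ using Finset.induction_on generalizing f with
  | empty => simp [bexp_empty]
  | insert x Λ hx ih =>
    have hins : Monotone fun ω : Finset V => insert x ω := fun a b h =>
      Finset.insert_subset_insert x h
    have h1 := ih (hf.comp hins)
    have h0 := ih hf
    have hf' : bexp p Λ f ≤ bexp p Λ (f ∘ fun ω => insert x ω) :=
      bexp_mono hp0 (hpq.trans hq1) fun ω _ => hf (Finset.subset_insert x ω)
    rw [bexp_insert p hx, bexp_insert q hx]
    simp only [Function.comp_def] at h1 hf'
    have h1' := mul_le_mul_of_nonneg_left h1 (hp0.trans hpq)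
    have h0' := mul_le_mul_of_nonneg_left h0 (sub_nonneg.2 hq1)
    have := mul_nonneg (sub_nonneg.2 hpq) (sub_nonneg.2 hf')
    nlinarith

/-- Russo's formula. -/
lemma hasDerivAt_bexp (p : ℝ) (Λ : Finset V) (f : Finset V → ℝ) :
    HasDerivAt (fun q => bexp q Λ f)
      (∑ x ∈ Λ, bexp p Λ fun ω => f (insert x ω) - f (ω.erase x)) p := by
  induction Λ using Finset.induction_on generalizing f with
  | empty => simpa [bexp_empty] using hasDerivAt_const p (f ∅)
  | insert x Λ hx ih =>
    simp only [bexp_insert _ hx]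
    have h := ((hasDerivAt_id p).mul (ih fun ω => f (insert x ω))).add
      (((hasDerivAt_id p).const_sub 1).mul (ih f))
    refine h.congr_deriv ?_
    rw [Finset.sum_insert hx, Finset.sum_add_distrib, ← Finset.mul_sum, ← Finset.mul_sum]
    have e1 : bexp p Λ (fun ω => f (insert x (insert x ω)) - f ((insert x ω).erase x)) =
        bexp p Λ (fun ω => f (insert x ω)) - bexp p Λ f := by
      rw [← bexp_sub]
      refine bexp_congr p fun ω hω => ?_
      rw [Finset.insert_idem, Finset.erase_insert fun h => hx (hω h)]
    have e2 : bexp p Λ (fun ω => f (insert x ω) - f (ω.erase x)) =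
        bexp p Λ (fun ω => f (insert x ω)) - bexp p Λ f := by
      rw [← bexp_sub]
      refine bexp_congr p fun ω hω => ?_
      rw [Finset.erase_eq_of_notMem fun h => hx (hω h)]
    have e3 : ∑ y ∈ Λ, bexp p Λ (fun ω => f (insert y (insert x ω)) - f ((insert x ω).erase y)) =
        ∑ y ∈ Λ, bexp p Λ (fun ω => f (insert x (insert y ω)) - f (insert x (ω.erase y))) := by
      refine Finset.sum_congr rfl fun y hy => bexp_congr p fun ω hω => ?_
      rw [Finset.insert_comm, Finset.erase_insert_of_ne fun h : x = y => hx (h ▸ hy)]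
    rw [e1, e2, e3]
    simp only [id]
    ring

end BernoulliExpectation

/-! ### Probabilities of events -/

section BernoulliProbability

variable {V : Type*} [DecidableEq V]

lemma bprob_congr (p : ℝ) {Λ : Finset V} {P Q : Finset V → Prop} (h : ∀ ω ⊆ Λ, (P ω ↔ Q ω)) :
    bprob p Λ P = bprob p Λ Q :=
  bexp_congr p fun ω hω => by rw [propext (h ω hω)]

lemma bprob_mono {p : ℝ} (hp0 : 0 ≤ p) (hp1 : p ≤ 1) {Λ : Finset V} {P Q : Finset V → Prop}
    (h : ∀ ω ⊆ Λ, P ω → Q ω) : bprob p Λ P ≤ bprob p Λ Q :=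
  bexp_mono hp0 hp1 fun ω hω => ind_mono (h ω hω)

lemma bprob_nonneg {p : ℝ} (hp0 : 0 ≤ p) (hp1 : p ≤ 1) (Λ : Finset V) (P : Finset V → Prop) :
    0 ≤ bprob p Λ P :=
  bexp_nonneg hp0 hp1 fun _ _ => ind_nonneg _

lemma bprob_not (p : ℝ) (Λ : Finset V) (P : Finset V → Prop) :
    bprob p Λ (fun ω => ¬ P ω) = 1 - bprob p Λ P := by
  unfold bprob
  conv_rhs => rw [← bexp_const p Λ 1, ← bexp_sub]
  exact bexp_congr p fun ω _ => by by_cases h : P ω <;> simp [ind, h]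

lemma bprob_le_one {p : ℝ} (hp0 : 0 ≤ p) (hp1 : p ≤ 1) (Λ : Finset V) (P : Finset V → Prop) :
    bprob p Λ P ≤ 1 := by
  have h := bprob_nonneg hp0 hp1 Λ fun ω => ¬ P ω
  rw [bprob_not] at h
  linarith

lemma bprob_or_le {p : ℝ} (hp0 : 0 ≤ p) (hp1 : p ≤ 1) (Λ : Finset V) (P Q : Finset V → Prop) :
    bprob p Λ (fun ω => P ω ∨ Q ω) ≤ bprob p Λ P + bprob p Λ Q := by
  unfold bprob
  rw [← bexp_add]
  refine bexp_mono hp0 hp1 fun ω _ => ?_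
  by_cases h : P ω <;> by_cases h' : Q ω <;> simp [ind, h, h']

lemma bprob_exists_le {ι : Type*} {p : ℝ} (hp0 : 0 ≤ p) (hp1 : p ≤ 1) (Λ : Finset V)
    (I : Finset ι) (P : ι → Finset V → Prop) :
    bprob p Λ (fun ω => ∃ i ∈ I, P i ω) ≤ ∑ i ∈ I, bprob p Λ (P i) := by
  unfold bprob
  rw [← bexp_sum]
  refine bexp_mono hp0 hp1 fun ω _ => ?_
  by_cases h : ∃ i ∈ I, P i ω
  · rw [ind_of h]
    obtain ⟨i, hi, h⟩ := h
    rw [← ind_of h]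
    exact Finset.single_le_sum (f := fun i => ind (P i ω)) (fun j _ => ind_nonneg _) hi
  · rw [ind_of_not h]
    exact Finset.sum_nonneg fun j _ => ind_nonneg _

/-- If `Q` implies `P`, the difference event has the difference of the probabilities. -/
lemma bprob_and_not (p : ℝ) (Λ : Finset V) {P Q : Finset V → Prop}
    (h : ∀ ω ⊆ Λ, Q ω → P ω) :
    bprob p Λ (fun ω => P ω ∧ ¬ Q ω) = bprob p Λ P - bprob p Λ Q := by
  unfold bprob
  rw [← bexp_sub]
  refine bexp_congr p fun ω hω => ?_
  have := h ω hω
  by_cases h' : Q ω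
  · simp [ind, h', this h']
  · have h2 : (P ω ∧ ¬ Q ω) = P ω := by simp [h']
    rw [ind_of_not h', sub_zero]
    exact congrArg ind h2

lemma bprob_local (p : ℝ) {A Λ : Finset V} (hA : A ⊆ Λ) {P : Finset V → Prop}
    (hP : ∀ ω, P ω ↔ P (ω ∩ A)) : bprob p Λ P = bprob p A P :=
  bexp_local p hA fun ω => by rw [propext (hP ω)]

lemma bprob_and_of_disjoint (p : ℝ) {A B Λ : Finset V} (hA : A ⊆ Λ) (hB : B ⊆ Λ)
    (hAB : Disjoint A B) {P Q : Finset V → Prop} (hP : ∀ ω, P ω ↔ P (ω ∩ A))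
    (hQ : ∀ ω, Q ω ↔ Q (ω ∩ B)) :
    bprob p Λ (fun ω => P ω ∧ Q ω) = bprob p Λ P * bprob p Λ Q := by
  rw [bprob_local p hA hP, bprob_local p hB hQ]
  unfold bprob
  rw [← bexp_mul_of_disjoint p hA hB hAB]
  · refine bexp_congr p fun ω _ => ?_
    by_cases h : P ω <;> by_cases h' : Q ω <;> simp [ind, h, h']
  · intro ω; rw [propext (hP ω)]
  · intro ω; rw [propext (hQ ω)]

lemma bprob_forall_of_disjoint {ι : Type*} (p : ℝ) {Λ : Finset V}
    (I : Finset ι) (D : ι → Finset V) (hD : ∀ i ∈ I, D i ⊆ Λ)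
    (hdisj : ∀ i ∈ I, ∀ j ∈ I, i ≠ j → Disjoint (D i) (D j)) (P : ι → Finset V → Prop)
    (hP : ∀ i ∈ I, ∀ ω, P i ω ↔ P i (ω ∩ D i)) :
    bprob p Λ (fun ω => ∀ i ∈ I, P i ω) = ∏ i ∈ I, bprob p Λ (P i) := by
  classical
  induction I using Finset.induction_on with
  | empty => simp [bprob, bexp_const, ind_of]
  | insert i I hi ih =>
    rw [Finset.prod_insert hi, ← ih (fun j hj => hD j (Finset.mem_insert_of_mem hj))
      (fun j hj k hk => hdisj j (Finset.mem_insert_of_mem hj) k (Finset.mem_insert_of_mem hk))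
      (fun j hj => hP j (Finset.mem_insert_of_mem hj)),
      ← bprob_and_of_disjoint p (hD i (Finset.mem_insert_self i I)) (B := I.biUnion D)
      (Finset.biUnion_subset.2 fun j hj => hD j (Finset.mem_insert_of_mem hj)) _
      (hP i (Finset.mem_insert_self i I))]
    · simp only [Finset.forall_mem_insert]
    · intro ω
      refine forall₂_congr fun j hj => ?_
      rw [hP j (Finset.mem_insert_of_mem hj),
        hP j (Finset.mem_insert_of_mem hj) (ω ∩ I.biUnion D), Finset.inter_assoc,
        Finset.inter_eq_right.2 (Finset.subset_biUnion_of_mem D hj)]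
    · rw [Finset.disjoint_biUnion_right]
      exact fun j hj => hdisj i (Finset.mem_insert_self i I) j (Finset.mem_insert_of_mem hj)
        fun h => hi (h ▸ hj)

lemma bprob_map {W : Type*} [DecidableEq W] (p : ℝ) (Λ : Finset V) (e : V ≃ W)
    (P : Finset W → Prop) :
    bprob p (Λ.map e.toEmbedding) P = bprob p Λ fun ω => P (ω.map e.toEmbedding) :=
  bexp_map p Λ e _

lemma bprob_compl (p : ℝ) (Λ : Finset V) (P : Finset V → Prop) :
    bprob p Λ (fun ω => P (Λ \ ω)) = bprob (1 - p) Λ P :=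
  bexp_compl p Λ fun ω => ind (P ω)

lemma bprob_le_bprob_of_le {p q : ℝ} (hp0 : 0 ≤ p) (hpq : p ≤ q) (hq1 : q ≤ 1) (Λ : Finset V)
    {P : Finset V → Prop} (hP : Monotone P) : bprob p Λ P ≤ bprob q Λ P :=
  bexp_le_bexp_of_le hp0 hpq hq1 Λ fun _ _ h => ind_mono (hP h)

/-- Harris's inequality for the complements of increasing events. -/
lemma bprob_not_mul_le {p : ℝ} (hp0 : 0 ≤ p) (hp1 : p ≤ 1) (Λ : Finset V)
    {P Q : Finset V → Prop} (hP : Monotone P) (hQ : Monotone Q) :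
    bprob p Λ (fun ω => ¬ P ω) * bprob p Λ (fun ω => ¬ Q ω) ≤
      bprob p Λ (fun ω => ¬ (P ω ∨ Q ω)) := by
  have h (R : Finset V → Prop) (hR : Monotone R) : Monotone fun ω => -ind (¬ R ω) :=
    fun a b hab => neg_le_neg (ind_mono fun h h' => h (hR hab h'))
  have key := bexp_mul_le_bexp_mul hp0 hp1 Λ (h P hP) (h Q hQ)
  have hneg (f : Finset V → ℝ) : bexp p Λ (fun ω => - f ω) = - bexp p Λ f := by
    simpa using bexp_const_mul p Λ (-1) f
  rw [hneg, hneg, neg_mul_neg] at key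
  refine key.trans (le_of_eq (bexp_congr p fun ω _ => ?_))
  by_cases h : P ω <;> by_cases h' : Q ω <;> simp [ind, h, h']

lemma pow_le_bprob_disjoint {p : ℝ} (hp0 : 0 ≤ p) (hp1 : p ≤ 1) (Λ N : Finset V) :
    (1 - p) ^ N.card ≤ bprob p Λ fun ω => Disjoint ω N := by
  have e : bprob p Λ (fun ω => Disjoint ω N) = bprob p Λ fun ω => Disjoint ω (Λ ∩ N) := by
    refine bprob_congr p fun ω hω => ?_
    simp only [Finset.disjoint_left, Finset.mem_inter]
    exact ⟨fun h a ha h' => h ha h'.2, fun h a ha h' => h ha ⟨hω ha, h'⟩⟩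
  rw [e, bprob_local p (A := Λ ∩ N) Finset.inter_subset_left]
  · have := weight_mul_le_bexp hp0 hp1 (Finset.empty_subset (Λ ∩ N))
      (f := fun ω => ind (Disjoint ω (Λ ∩ N))) (fun ω _ => ind_nonneg _)
    rw [ind_of (Finset.disjoint_empty_left _), Finset.card_empty, pow_zero, one_mul,
      Finset.sdiff_empty, mul_one] at this
    exact (pow_le_pow_of_le_one (by linarith) (by linarith)
      (Finset.card_le_card Finset.inter_subset_right)).trans this
  · intro ω
    simp only [Finset.disjoint_left, Finset.mem_inter]
    exact ⟨fun h a ha => h ha.1, fun h a ha h' => h ⟨ha, h'⟩ h'⟩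

lemma pow_le_bprob_subset {p : ℝ} (hp0 : 0 ≤ p) (hp1 : p ≤ 1) {Λ N : Finset V} (hN : N ⊆ Λ) :
    p ^ N.card ≤ bprob p Λ fun ω => N ⊆ ω := by
  rw [bprob_local p hN]
  · have := weight_mul_le_bexp hp0 hp1 (Finset.Subset.refl N)
      (f := fun ω => ind (N ⊆ ω)) (fun ω _ => ind_nonneg _)
    rwa [ind_of (Finset.Subset.refl N), Finset.sdiff_self, Finset.card_empty, pow_zero, mul_one,
      mul_one] at this
  · intro ω
    simp [Finset.subset_inter_iff]

end BernoulliProbability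

/-! ### Connections in the triangular lattice -/

section Connections

lemma triAdj_iff {u v : Site} : triAdj u v ↔
    (u.1 = v.1 + 1 ∧ u.2 = v.2) ∨ (u.1 = v.1 - 1 ∧ u.2 = v.2) ∨
    (u.1 = v.1 ∧ u.2 = v.2 + 1) ∨ (u.1 = v.1 ∧ u.2 = v.2 - 1) ∨
    (u.1 = v.1 + 1 ∧ u.2 = v.2 + 1) ∨ (u.1 = v.1 - 1 ∧ u.2 = v.2 - 1) := by
  simp only [triAdj, Set.mem_insert_iff, Set.mem_singleton_iff, Prod.ext_iff, Prod.fst_sub,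
    Prod.snd_sub]
  omega

lemma triAdj_symm {u v : Site} (h : triAdj u v) : triAdj v u := by
  rw [triAdj_iff] at *; omega

/-- The six neighbours of a site. -/
def nbrs (v : Site) : Finset Site :=
  {(v.1 + 1, v.2), (v.1 - 1, v.2), (v.1, v.2 + 1), (v.1, v.2 - 1), (v.1 + 1, v.2 + 1),
    (v.1 - 1, v.2 - 1)}

lemma mem_nbrs {v w : Site} : w ∈ nbrs v ↔ triAdj v w := by
  simp only [nbrs, Finset.mem_insert, Finset.mem_singleton, Prod.ext_iff, triAdj_iff]
  omega

lemma card_nbrs_le (v : Site) : (nbrs v).card ≤ 6 := Finset.card_le_six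

/-- `u` and `v` are joined by a path of sites of `A`. -/
def Linked (A : Set Site) (u v : Site) : Prop :=
  u ∈ A ∧ Relation.ReflTransGen (fun a b => triAdj a b ∧ b ∈ A) u v

namespace Linked

variable {A B D : Set Site} {u v w : Site}

lemma refl (h : u ∈ A) : Linked A u u := ⟨h, .refl⟩

lemma left_mem (h : Linked A u v) : u ∈ A := h.1

lemma right_mem (h : Linked A u v) : v ∈ A := by
  obtain ⟨hu, h⟩ := h
  induction h with
  | refl => exact hu
  | tail _ h _ => exact h.2

lemma mono (h : Linked A u v) (hAB : A ⊆ B) : Linked B u v :=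
  ⟨hAB h.1, Relation.ReflTransGen.mono (fun _ _ h => ⟨h.1, hAB h.2⟩) _ _ h.2⟩

lemma tail (h : Linked A u v) (hvw : triAdj v w) (hw : w ∈ A) : Linked A u w :=
  ⟨h.1, h.2.tail ⟨hvw, hw⟩⟩

lemma trans (h : Linked A u v) (h' : Linked A v w) : Linked A u w :=
  ⟨h.1, h.2.trans h'.2⟩

lemma symm (h : Linked A u v) : Linked A v u := by
  obtain ⟨hu, h⟩ := h
  induction h with
  | refl => exact refl hu
  | tail h1 h2 ih =>
    exact ((refl h2.2).tail (triAdj_symm h2.1) (Linked.right_mem ⟨hu, h1⟩)).trans ih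

/-- A path that starts in `D` either stays in `D` or leaves it. -/
lemma exit (h : Linked A u v) (hu : u ∈ D) :
    Linked (A ∩ D) u v ∨ ∃ w w', triAdj w w' ∧ Linked (A ∩ D) u w ∧ w' ∉ D ∧ w' ∈ A := by
  obtain ⟨huA, h⟩ := h
  induction h with
  | refl => exact Or.inl (refl ⟨huA, hu⟩)
  | @tail b c h1 h2 ih =>
    rcases ih with ih | ih
    · by_cases hc : c ∈ D
      · exact Or.inl (ih.tail h2.1 ⟨h2.2, hc⟩)
      · exact Or.inr ⟨b, c, h2.1, ih, hc, h2.2⟩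
    · exact Or.inr ih

lemma image (e : Site ≃ Site) (he : ∀ u v, triAdj u v → triAdj (e u) (e v))
    (h : Linked A u v) : Linked (e '' A) (e u) (e v) := by
  obtain ⟨huA, h⟩ := h
  induction h with
  | refl => exact refl (Set.mem_image_of_mem e huA)
  | tail h1 h2 ih => exact ih.tail (he _ _ h2.1) (Set.mem_image_of_mem e h2.2)

end Linked

/-- Some site of `B` is joined to some site of `T` by a path of open sites of `D`. -/
def Reach (D : Finset Site) (B T : Set Site) (ω : Finset Site) : Prop :=
  ∃ u ∈ B, ∃ v ∈ T, Linked (↑(ω ∩ D) : Set Site) u v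

namespace Reach

variable {D D' ω ω' : Finset Site} {B B' T T' : Set Site}

lemma mono (h : Reach D B T ω) (hD : D ⊆ D') (hB : B ⊆ B') (hT : T ⊆ T') (hω : ω ⊆ ω') :
    Reach D' B' T' ω' := by
  obtain ⟨u, hu, v, hv, h⟩ := h
  exact ⟨u, hB hu, v, hT hv, h.mono (Finset.coe_subset.2 (Finset.inter_subset_inter hω hD))⟩

lemma monotone (D : Finset Site) (B T : Set Site) : Monotone (Reach D B T) :=
  fun _ _ hω h => h.mono subset_rfl subset_rfl subset_rfl hω

lemma inter_iff (hD : D ⊆ D') : Reach D B T ω ↔ Reach D B T (ω ∩ D') := by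
  unfold Reach
  rw [Finset.inter_assoc, Finset.inter_eq_right.2 hD]

/-- A connection that starts in `D` yields a connection inside `D` to any set that contains all
sites from which `D` can be left. -/
lemma restrict (h : Reach D' B T ω) (hB : B ⊆ D) (hT : T ∩ D ⊆ T')
    (hexit : ∀ w ∈ D, ∀ w' ∉ D, triAdj w w' → w ∈ T') : Reach D B T' ω := by
  obtain ⟨u, hu, v, hv, h⟩ := h
  have hsub : (↑(ω ∩ D') : Set Site) ∩ ↑D ⊆ ↑(ω ∩ D) := by
    intro x hx
    simp only [Finset.coe_inter, Set.mem_inter_iff] at hx ⊢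
    exact ⟨hx.1.1, hx.2⟩
  rcases h.exit (hB hu) with h | ⟨w, w', hw, h, hw', -⟩
  · exact ⟨u, hu, v, hT ⟨hv, h.right_mem.2⟩, h.mono hsub⟩
  · exact ⟨u, hu, w, hexit w h.right_mem.2 w' hw' hw, h.mono hsub⟩

lemma map (e : Site ≃ Site) (he : ∀ u v, triAdj u v → triAdj (e u) (e v))
    (h : Reach D B T ω) :
    Reach (D.map e.toEmbedding) (e '' B) (e '' T) (ω.map e.toEmbedding) := by
  obtain ⟨u, hu, v, hv, h⟩ := h
  refine ⟨e u, Set.mem_image_of_mem e hu, e v, Set.mem_image_of_mem e hv, ?_⟩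
  rw [← Finset.map_inter, Finset.coe_map]
  exact h.image e he

lemma map_iff (e : Site ≃ Site) (he : ∀ u v, triAdj (e u) (e v) ↔ triAdj u v) :
    Reach (D.map e.toEmbedding) (e '' B) (e '' T) (ω.map e.toEmbedding) ↔ Reach D B T ω := by
  refine ⟨fun h => ?_, fun h => h.map e fun u v => (he u v).2⟩
  have := h.map e.symm fun u v h => (he _ _).1 (by simpa using h)
  simpa [Finset.map_map, ← Equiv.trans_toEmbedding, Set.image_image] using this

lemma bprob_map (p : ℝ) (e : Site ≃ Site) (he : ∀ u v, triAdj (e u) (e v) ↔ triAdj u v)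
    (Λ D : Finset Site) (B T : Set Site) :
    bprob p (Λ.map e.toEmbedding) (Reach (D.map e.toEmbedding) (e '' B) (e '' T)) =
      bprob p Λ (Reach D B T) := by
  rw [_root_.bprob_map]
  exact bprob_congr p fun ω _ => map_iff e he

lemma bprob_ambient (p : ℝ) {Λ : Finset Site} (h : D ⊆ Λ) :
    bprob p Λ (Reach D B T) = bprob p D (Reach D B T) :=
  bprob_local p h fun _ => inter_iff subset_rfl

end Reach

/-- The box `x + {-k, …, k}²`. -/
noncomputable def ball (x : Site) (k : ℕ) : Finset Site :=
  Finset.Icc (x.1 - k) (x.1 + k) ×ˢ Finset.Icc (x.2 - k) (x.2 + k)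

lemma mem_ball {x v : Site} {k : ℕ} : v ∈ ball x k ↔
    x.1 - k ≤ v.1 ∧ v.1 ≤ x.1 + k ∧ x.2 - k ≤ v.2 ∧ v.2 ≤ x.2 + k := by
  simp [ball, Finset.mem_product, and_assoc]

/-- The boundary of the box `ball x k`, extended to four full lines. -/
def frame (x : Site) (k : ℕ) : Set Site :=
  {v | v.1 = x.1 + k ∨ v.1 = x.1 - k ∨ v.2 = x.2 + k ∨ v.2 = x.2 - k}

lemma mem_frame {x v : Site} {k : ℕ} : v ∈ frame x k ↔
    v.1 = x.1 + k ∨ v.1 = x.1 - k ∨ v.2 = x.2 + k ∨ v.2 = x.2 - k := Iff.rfl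

lemma mem_frame_of_exit {x w w' : Site} {k : ℕ} (hw : w ∈ ball x k) (hw' : w' ∉ ball x k)
    (h : triAdj w w') : w ∈ frame x k := by
  rw [mem_ball] at hw hw'
  rw [triAdj_iff] at h
  rw [mem_frame]
  omega

lemma triAdj_addRight (x u v : Site) :
    triAdj (Equiv.addRight x u) (Equiv.addRight x v) ↔ triAdj u v := by
  simp [triAdj]

lemma triAdj_neg (u v : Site) : triAdj (Equiv.neg Site u) (Equiv.neg Site v) ↔ triAdj u v := by
  simp only [triAdj_iff, Equiv.neg_apply, Prod.fst_neg, Prod.snd_neg]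
  omega

lemma triAdj_swap (u v : Site) :
    triAdj (Equiv.prodComm ℤ ℤ u) (Equiv.prodComm ℤ ℤ v) ↔ triAdj u v := by
  simp only [triAdj_iff, Equiv.prodComm_apply, Prod.fst_swap, Prod.snd_swap]
  omega

lemma ball_map_addRight (y x : Site) (k : ℕ) :
    (ball y k).map (Equiv.addRight x).toEmbedding = ball (y + x) k := by
  ext v
  rw [Finset.mem_map_equiv]
  simp only [mem_ball, Equiv.addRight_symm, Equiv.coe_addRight, Prod.fst_add, Prod.snd_add,
    Prod.fst_neg, Prod.snd_neg]
  omega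

lemma frame_image_addRight (y x : Site) (k : ℕ) :
    Equiv.addRight x '' frame y k = frame (y + x) k := by
  ext v
  rw [Equiv.image_eq_preimage_symm, Set.mem_preimage]
  simp only [mem_frame, Equiv.addRight_symm, Equiv.coe_addRight, Prod.fst_add, Prod.snd_add,
    Prod.fst_neg, Prod.snd_neg]
  omega

lemma ball_map_neg (x : Site) (k : ℕ) :
    (ball x k).map (Equiv.neg Site).toEmbedding = ball (-x) k := by
  ext v
  rw [Finset.mem_map_equiv]
  simp only [mem_ball, Equiv.neg_symm, Equiv.neg_apply, Prod.fst_neg, Prod.snd_neg]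
  omega

lemma ball_map_swap (x : Site) (k : ℕ) :
    (ball x k).map (Equiv.prodComm ℤ ℤ).toEmbedding = ball x.swap k := by
  ext v
  rw [Finset.mem_map_equiv]
  simp only [mem_ball, Equiv.prodComm_symm, Equiv.prodComm_apply, Prod.fst_swap, Prod.snd_swap]
  omega

lemma linked_ball_aux {x : Site} {k : ℕ} {A : Set Site} (hA : (ball x k : Set Site) ⊆ A)
    (n : ℕ) : ∀ {u v : Site}, u ∈ ball x k → v ∈ ball x k →
      (u.1 - v.1).natAbs + (u.2 - v.2).natAbs = n → Linked A u v := by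
  induction n with
  | zero =>
    intro u v hu hv h
    have : u = v := Prod.ext (by omega) (by omega)
    exact this ▸ Linked.refl (hA hu)
  | succ n ih =>
    intro u v hu hv h
    obtain ⟨w, hw, hwv, hd⟩ : ∃ w ∈ ball x k, triAdj w v ∧
        (u.1 - w.1).natAbs + (u.2 - w.2).natAbs = n := by
      simp only [mem_ball, triAdj_iff] at *
      rcases lt_trichotomy u.1 v.1 with h1 | h1 | h1
      · exact ⟨(v.1 - 1, v.2), by dsimp only; omega, by dsimp only; omega, by dsimp only; omega⟩
      · rcases lt_or_ge u.2 v.2 with h2 | h2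
        · exact ⟨(v.1, v.2 - 1), by dsimp only; omega, by dsimp only; omega,
            by dsimp only; omega⟩
        · exact ⟨(v.1, v.2 + 1), by dsimp only; omega, by dsimp only; omega,
            by dsimp only; omega⟩
      · exact ⟨(v.1 + 1, v.2), by dsimp only; omega, by dsimp only; omega, by dsimp only; omega⟩
    exact (ih hu hw hd).tail hwv (hA hv)

lemma linked_ball {x : Site} {k : ℕ} {A : Set Site} (hA : (ball x k : Set Site) ⊆ A)
    {u v : Site} (hu : u ∈ ball x k) (hv : v ∈ ball x k) : Linked A u v :=
  linked_ball_aux hA _ hu hv rfl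

end Connections

/-! ### Exponential moments of the cluster size -/

section ExponentialMoment

open Classical in
/-- The sites joined to `Y` by a path in `ω`. -/
noncomputable def cluster (Y ω : Finset Site) : Finset Site :=
  ω.filter fun v => ∃ y ∈ Y, Linked ↑ω y v

lemma mem_cluster {Y ω : Finset Site} {v : Site} :
    v ∈ cluster Y ω ↔ ∃ y ∈ Y, Linked ↑ω y v := by
  simp only [cluster, Finset.mem_filter, and_iff_right_iff_imp]
  rintro ⟨y, -, h⟩
  exact h.right_mem

lemma mem_cluster_singleton {y v : Site} {ω : Finset Site} :
    v ∈ cluster {y} ω ↔ Linked ↑ω y v := by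
  simp [mem_cluster]

lemma cluster_subset (Y ω : Finset Site) : cluster Y ω ⊆ ω := by
  classical exact Finset.filter_subset _ _

lemma cluster_mono {Y ω ω' : Finset Site} (h : ω ⊆ ω') : cluster Y ω ⊆ cluster Y ω' := by
  intro v hv
  rw [mem_cluster] at *
  obtain ⟨y, hy, hv⟩ := hv
  exact ⟨y, hy, hv.mono (Finset.coe_subset.2 h)⟩

/-- The sites outside `S` that are adjacent to the cluster of `x` inside `S`. -/
noncomputable def exitSites (S : Finset Site) (x : Site) (ω : Finset Site) : Finset Site :=
  (cluster {x} (ω ∩ S)).biUnion nbrs \ S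

lemma mem_exitSites {S ω : Finset Site} {x w : Site} : w ∈ exitSites S x ω ↔
    w ∉ S ∧ ∃ v, Linked (↑(ω ∩ S) : Set Site) x v ∧ triAdj v w := by
  simp only [exitSites, Finset.mem_sdiff, Finset.mem_biUnion, mem_cluster_singleton, mem_nbrs]
  tauto

lemma exitSites_mono (S : Finset Site) (x : Site) : Monotone (exitSites S x) := by
  intro ω ω' h
  exact Finset.sdiff_subset_sdiff (Finset.biUnion_subset_biUnion_of_subset_left _
    (cluster_mono (Finset.inter_subset_inter_right h))) subset_rfl

lemma exitSites_inter {S T ω : Finset Site} (h : S ⊆ T) (x : Site) :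
    exitSites S x (ω ∩ T) = exitSites S x ω := by
  rw [exitSites, exitSites, Finset.inter_assoc, Finset.inter_eq_right.2 h]

lemma card_exitSites_le (S : Finset Site) (x : Site) (ω : Finset Site) :
    (exitSites S x ω).card ≤ S.card * 6 :=
  calc (exitSites S x ω).card ≤ ((cluster {x} (ω ∩ S)).biUnion nbrs).card :=
        Finset.card_le_card Finset.sdiff_subset
    _ ≤ (cluster {x} (ω ∩ S)).card * 6 :=
        Finset.card_biUnion_le_card_mul _ _ _ fun v _ => card_nbrs_le v
    _ ≤ S.card * 6 := Nat.mul_le_mul_right _ (Finset.card_le_card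
        ((cluster_subset _ _).trans Finset.inter_subset_right))

lemma exitSites_map_subset (e : Site ≃ Site) (he : ∀ u v, triAdj u v → triAdj (e u) (e v))
    (S : Finset Site) (x : Site) (ω : Finset Site) :
    (exitSites S x ω).map e.toEmbedding ⊆
      exitSites (S.map e.toEmbedding) (e x) (ω.map e.toEmbedding) := by
  intro w' hw'
  obtain ⟨w, hw, rfl⟩ := Finset.mem_map.1 hw'
  obtain ⟨hwS, v, hv, hvw⟩ := mem_exitSites.1 hw
  refine mem_exitSites.2 ⟨by simpa using hwS, e v, ?_, he _ _ hvw⟩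
  rw [← Finset.map_inter, Finset.coe_map]
  exact hv.image e he

lemma card_exitSites_map (e : Site ≃ Site) (he : ∀ u v, triAdj (e u) (e v) ↔ triAdj u v)
    (S : Finset Site) (x : Site) (ω : Finset Site) :
    (exitSites (S.map e.toEmbedding) (e x) (ω.map e.toEmbedding)).card =
      (exitSites S x ω).card := by
  apply le_antisymm
  · have := Finset.card_le_card (exitSites_map_subset e.symm
      (fun u v h => (he _ _).1 (by simpa using h)) (S.map e.toEmbedding) (e x)
      (ω.map e.toEmbedding))
    simpa [Finset.map_map, ← Equiv.trans_toEmbedding] using this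
  · simpa using Finset.card_le_card (exitSites_map_subset e (fun u v => (he u v).2) S x ω)

/-- The sites of `T` whose state is revealed when the cluster `K` of `y` in `T` is explored. -/
def revealed (T : Finset Site) (y : Site) (K : Finset Site) : Finset Site :=
  insert y (K ∪ K.biUnion nbrs) ∩ T

lemma mem_revealed {T K : Finset Site} {y v : Site} : v ∈ revealed T y K ↔
    (v = y ∨ v ∈ K ∨ ∃ u ∈ K, triAdj u v) ∧ v ∈ T := by
  simp [revealed, mem_nbrs]

lemma cluster_eq_iff_inter_revealed {T ω K : Finset Site} {y : Site} :
    cluster {y} (ω ∩ T) = K ↔ cluster {y} (ω ∩ revealed T y K ∩ T) = K := by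
  have hsub : ω ∩ revealed T y K ∩ T ⊆ ω ∩ T :=
    Finset.inter_subset_inter_right Finset.inter_subset_left
  constructor
  · intro hK
    refine subset_antisymm ((cluster_mono hsub).trans hK.subset) fun v hv => ?_
    have hv' : Linked (↑(ω ∩ T) : Set Site) y v := by
      rwa [← mem_cluster_singleton, hK]
    rw [mem_cluster_singleton]
    obtain ⟨hy, h⟩ := hv'
    clear hv
    simp only [Finset.coe_inter, Set.mem_inter_iff, Finset.mem_coe] at hy
    induction h with
    | refl =>
      refine Linked.refl ?_
      simp only [Finset.coe_inter, Set.mem_inter_iff, Finset.mem_coe, mem_revealed]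
      exact ⟨⟨hy.1, Or.inl trivial, hy.2⟩, hy.2⟩
    | @tail b c h1 h2 ih =>
      refine ih.tail h2.1 ?_
      have hb : b ∈ K := by
        rw [← hK, mem_cluster_singleton]
        exact ih.mono (Finset.coe_subset.2 hsub)
      have hc := h2.2
      simp only [Finset.coe_inter, Set.mem_inter_iff, Finset.mem_coe] at hc
      simp only [Finset.coe_inter, Set.mem_inter_iff, Finset.mem_coe, mem_revealed]
      exact ⟨⟨hc.1, Or.inr (Or.inr ⟨b, hb, h2.1⟩), hc.2⟩, hc.2⟩
  · intro hK
    refine subset_antisymm (fun v hv => ?_) (hK.symm.subset.trans (cluster_mono hsub))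
    rw [mem_cluster_singleton] at hv
    obtain ⟨hy, h⟩ := hv
    simp only [Finset.coe_inter, Set.mem_inter_iff, Finset.mem_coe] at hy
    have hmem (w : Site) : w ∈ K ↔ Linked (↑(ω ∩ revealed T y K ∩ T) : Set Site) y w := by
      rw [← mem_cluster_singleton, hK]
    induction h with
    | refl =>
      rw [hmem]
      refine Linked.refl ?_
      simp only [Finset.coe_inter, Set.mem_inter_iff, Finset.mem_coe, mem_revealed]
      exact ⟨⟨hy.1, Or.inl trivial, hy.2⟩, hy.2⟩
    | @tail b c h1 h2 ih =>
      rw [hmem]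
      refine ((hmem b).1 ih).tail h2.1 ?_
      have hc := h2.2
      simp only [Finset.coe_inter, Set.mem_inter_iff, Finset.mem_coe] at hc
      simp only [Finset.coe_inter, Set.mem_inter_iff, Finset.mem_coe, mem_revealed]
      exact ⟨⟨hc.1, Or.inr (Or.inr ⟨b, ih, h2.1⟩), hc.2⟩, hc.2⟩

/-- After exploring the cluster of `y` inside `T`, the rest of the cluster of `insert y Y` is
found from the exit sites, in the unexplored region. -/
lemma cluster_insert_subset {T : Finset Site} {y : Site} (hy : y ∈ T) (Y ω : Finset Site) :
    cluster (insert y Y) ω ⊆ cluster {y} (ω ∩ T) ∪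
      cluster (exitSites T y ω ∪ Y) (ω \ revealed T y (cluster {y} (ω ∩ T))) := by
  set K := cluster {y} (ω ∩ T) with hKdef
  have hmem (w : Site) : w ∈ K ↔ Linked (↑(ω ∩ T) : Set Site) y w := by
    rw [← mem_cluster_singleton]
  have hKω : ∀ w ∈ ω, w ∈ revealed T y K → w ∈ K := by
    intro w hw hwR
    obtain ⟨h, hwT⟩ := mem_revealed.1 hwR
    have hw' : w ∈ (↑(ω ∩ T) : Set Site) := by simp [hw, hwT]
    rcases h with rfl | h | ⟨u, hu, huw⟩
    · exact (hmem w).2 (Linked.refl hw')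
    · exact h
    · exact (hmem w).2 (((hmem u).1 hu).tail huw hw')
  intro v hv
  obtain ⟨u, hu, huω, h⟩ := mem_cluster.1 hv
  clear hv
  rw [Finset.mem_coe] at huω
  induction h with
  | refl =>
    by_cases huR : u ∈ revealed T y K
    · exact Finset.mem_union_left _ (hKω u huω huR)
    · refine Finset.mem_union_right _ (mem_cluster.2 ⟨u, ?_, Linked.refl ?_⟩)
      · rcases Finset.mem_insert.1 hu with rfl | hu
        · exact absurd (mem_revealed.2 ⟨Or.inl rfl, hy⟩) huR
        · exact Finset.mem_union_right _ hu
      · simp [huω, huR]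
  | @tail b c h1 h2 ih =>
    have hc : c ∈ ω := h2.2
    by_cases hcR : c ∈ revealed T y K
    · exact Finset.mem_union_left _ (hKω c hc hcR)
    · have hc' : c ∈ (↑(ω \ revealed T y K) : Set Site) := by simp [hc, hcR]
      refine Finset.mem_union_right _ ?_
      rcases Finset.mem_union.1 ih with hb | hb
      · refine mem_cluster.2 ⟨c, Finset.mem_union_left _ (mem_exitSites.2 ⟨fun hcT => ?_, b,
          (hmem b).1 hb, h2.1⟩), Linked.refl hc'⟩
        exact hcR (mem_revealed.2 ⟨Or.inr (Or.inr ⟨b, hb, h2.1⟩), hcT⟩)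
      · obtain ⟨s, hs, hsb⟩ := mem_cluster.1 hb
        exact mem_cluster.2 ⟨s, hs, hsb.tail h2.1 hc'⟩

lemma bexp_pow_card_cluster_le {p z m : ℝ} (hp0 : 0 ≤ p) (hp1 : p ≤ 1) (hz : 1 ≤ z)
    (hm : 1 ≤ m) {S : Finset Site} (hS : (0 : Site) ∈ S)
    (hkey : z ^ S.card * bexp p S (fun ω => m ^ (exitSites S 0 ω).card) ≤ m)
    (A Y : Finset Site) :
    bexp p A (fun ω => z ^ (cluster Y ω).card) ≤ m ^ Y.card := by
  induction A using Finset.strongInduction generalizing Y with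
  | H A ih =>
  by_cases hYA : ∃ y ∈ Y, y ∈ A
  swap
  · push Not at hYA
    rw [bexp_congr p (g := fun _ => 1), bexp_const]
    · exact one_le_pow₀ hm
    · intro ω hω
      have : cluster Y ω = ∅ := Finset.eq_empty_of_forall_notMem fun v hv => by
        obtain ⟨y, hy, h⟩ := mem_cluster.1 hv
        exact hYA y hy (hω h.left_mem)
      simp [this]
  obtain ⟨y, hyY, hyA⟩ := hYA
  obtain ⟨Y', hyY', rfl⟩ : ∃ Y', y ∉ Y' ∧ Y = insert y Y' :=
    ⟨Y.erase y, Finset.notMem_erase y Y, (Finset.insert_erase hyY).symm⟩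
  set T := S.map (Equiv.addRight y).toEmbedding with hT
  have hyT : y ∈ T := by
    rw [hT, Finset.mem_map_equiv]; simpa using hS
  set Kf : Finset Site → Finset Site := fun ω => cluster {y} (ω ∩ T) with hKf
  set J : Finset Site → Finset Site := fun K => K.biUnion nbrs \ T with hJ
  have hz0 : 0 ≤ z := by linarith
  have hm0 : 0 ≤ m := by linarith
  have step1 : bexp p A (fun ω => z ^ (cluster (insert y Y') ω).card) ≤
      bexp p A (fun ω => ∑ K ∈ A.powerset, ind (Kf (ω ∩ (A ∩ revealed T y K)) = K) *
        (z ^ K.card * z ^ (cluster (J K ∪ Y') (ω ∩ (A \ revealed T y K))).card)) := by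
    refine bexp_mono hp0 hp1 fun ω hω => ?_
    have hKA : Kf ω ∈ A.powerset := Finset.mem_powerset.2
      ((cluster_subset _ _).trans (Finset.inter_subset_left.trans hω))
    have e1 (K : Finset Site) : ω ∩ (A ∩ revealed T y K) = ω ∩ revealed T y K := by
      rw [← Finset.inter_assoc, Finset.inter_eq_left.2 hω]
    have e2 (K : Finset Site) : ω ∩ (A \ revealed T y K) = ω \ revealed T y K := by
      rw [← Finset.inter_sdiff_assoc, Finset.inter_eq_left.2 hω]
    refine le_trans ?_ (Finset.single_le_sum (fun K _ => ?_) hKA)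
    · rw [ind_of (by rw [e1]; exact cluster_eq_iff_inter_revealed.1 rfl), one_mul, e2, ← pow_add]
      exact pow_le_pow_right₀ hz ((Finset.card_le_card (cluster_insert_subset hyT Y' ω)).trans
        (Finset.card_union_le _ _))
    · have := ind_nonneg (Kf (ω ∩ (A ∩ revealed T y K)) = K)
      positivity
  have step2 (K : Finset Site) : bexp p A (fun ω =>
      ind (Kf (ω ∩ (A ∩ revealed T y K)) = K) *
        (z ^ K.card * z ^ (cluster (J K ∪ Y') (ω ∩ (A \ revealed T y K))).card)) ≤
      bexp p A (fun ω => ind (Kf ω = K) * (z ^ K.card * m ^ ((J K).card + Y'.card))) := by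
    rw [bexp_mul_of_disjoint p (A := A ∩ revealed T y K) (B := A \ revealed T y K)
      (f := fun ω => ind (Kf (ω ∩ (A ∩ revealed T y K)) = K))
      (g := fun ω => z ^ K.card * z ^ (cluster (J K ∪ Y') (ω ∩ (A \ revealed T y K))).card)
      Finset.inter_subset_left Finset.sdiff_subset
      (Finset.disjoint_sdiff.mono_left Finset.inter_subset_right)
      (fun ω => by simp only [Finset.inter_assoc, Finset.inter_self])
      (fun ω => by simp only [Finset.inter_assoc, Finset.inter_self])]
    rw [bexp_const_mul]
    have hrest : bexp p (A \ revealed T y K)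
        (fun ω => z ^ (cluster (J K ∪ Y') (ω ∩ (A \ revealed T y K))).card) ≤
        m ^ ((J K).card + Y'.card) := by
      rw [bexp_congr p (g := fun ω => z ^ (cluster (J K ∪ Y') ω).card)
        fun ω hω => by rw [Finset.inter_eq_left.2 hω]]
      refine (ih _ ?_ _).trans (pow_le_pow_right₀ hm (Finset.card_union_le _ _))
      exact (Finset.ssubset_iff_of_subset Finset.sdiff_subset).2
        ⟨y, hyA, by simp [mem_revealed, hyT]⟩
    have e : bexp p (A ∩ revealed T y K) (fun ω => ind (Kf (ω ∩ (A ∩ revealed T y K)) = K)) =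
        bexp p A fun ω => ind (Kf ω = K) := by
      rw [← bexp_local p (Λ := A) Finset.inter_subset_left
        (fun ω => by simp only [Finset.inter_assoc, Finset.inter_self])]
      refine bexp_congr p fun ω hω => ?_
      rw [← Finset.inter_assoc, Finset.inter_eq_left.2 hω]
      exact congrArg ind (propext cluster_eq_iff_inter_revealed.symm)
    rw [e, mul_comm, ← bexp_const_mul]
    refine bexp_mono hp0 hp1 fun ω _ => ?_
    rw [mul_comm]
    exact mul_le_mul_of_nonneg_left (mul_le_mul_of_nonneg_left hrest (by positivity))
      (ind_nonneg _)
  have step3 : bexp p A (fun ω => z ^ (cluster (insert y Y') ω).card) ≤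
      bexp p A (fun ω => z ^ (Kf ω).card * m ^ ((J (Kf ω)).card + Y'.card)) := by
    refine step1.trans ?_
    rw [bexp_sum]
    refine (Finset.sum_le_sum fun K _ => step2 K).trans (le_of_eq ?_)
    rw [← bexp_sum]
    refine bexp_congr p fun ω hω => ?_
    have hKA : Kf ω ∈ A.powerset := Finset.mem_powerset.2
      ((cluster_subset _ _).trans (Finset.inter_subset_left.trans hω))
    rw [Finset.sum_eq_single_of_mem _ hKA fun K _ hK => by rw [ind_of_not (Ne.symm hK), zero_mul],
      ind_of rfl, one_mul]
  have step4 : bexp p A (fun ω => z ^ (Kf ω).card * m ^ ((J (Kf ω)).card + Y'.card)) ≤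
      (m ^ Y'.card * z ^ S.card) * bexp p A (fun ω => m ^ (exitSites T y ω).card) := by
    rw [← bexp_const_mul]
    refine bexp_mono hp0 hp1 fun ω hω => ?_
    have hc : (Kf ω).card ≤ S.card := by
      rw [← Finset.card_map (Equiv.addRight y).toEmbedding (s := S)]
      exact Finset.card_le_card ((cluster_subset _ _).trans Finset.inter_subset_right)
    have hzc := pow_le_pow_right₀ hz hc
    rw [pow_add]
    calc z ^ (Kf ω).card * (m ^ (J (Kf ω)).card * m ^ Y'.card)
        ≤ z ^ S.card * (m ^ (J (Kf ω)).card * m ^ Y'.card) := by gcongr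
      _ = _ := by
        change _ = m ^ Y'.card * z ^ S.card * m ^ (J (Kf ω)).card
        ring
  have step5 : bexp p A (fun ω => m ^ (exitSites T y ω).card) ≤
      bexp p S (fun ω => m ^ (exitSites S 0 ω).card) := by
    calc bexp p A (fun ω => m ^ (exitSites T y ω).card)
        ≤ bexp p (A ∪ T) (fun ω => m ^ (exitSites T y ω).card) := by
          rw [bexp_congr p (g := fun ω => m ^ (exitSites T y (ω ∩ A)).card)
              fun ω hω => by rw [Finset.inter_eq_left.2 hω],
            ← bexp_local p (A := A) (Λ := A ∪ T)
            (f := fun ω => m ^ (exitSites T y (ω ∩ A)).card) Finset.subset_union_left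
            (fun ω => by simp only [Finset.inter_assoc, Finset.inter_self])]
          · exact bexp_mono hp0 hp1 fun ω _ => pow_le_pow_right₀ hm
              (Finset.card_le_card (exitSites_mono T y Finset.inter_subset_left))
      _ = bexp p T (fun ω => m ^ (exitSites T y ω).card) :=
          bexp_local p Finset.subset_union_right fun ω => by rw [exitSites_inter subset_rfl]
      _ = bexp p S (fun ω => m ^ (exitSites S 0 ω).card) := by
          rw [hT, bexp_map]
          refine bexp_congr p fun ω _ => ?_
          rw [← card_exitSites_map (Equiv.addRight y) (triAdj_addRight y) S 0 ω]
          simp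
  calc bexp p A (fun ω => z ^ (cluster (insert y Y') ω).card)
      ≤ (m ^ Y'.card * z ^ S.card) * bexp p S (fun ω => m ^ (exitSites S 0 ω).card) :=
        (step3.trans step4).trans (mul_le_mul_of_nonneg_left step5 (by positivity))
    _ = m ^ Y'.card * (z ^ S.card * bexp p S (fun ω => m ^ (exitSites S 0 ω).card)) := by ring
    _ ≤ m ^ Y'.card * m := by gcongr
    _ = m ^ (insert y Y').card := by rw [Finset.card_insert_of_notMem hyY', pow_succ]

lemma one_add_pow_le {δ : ℝ} (h0 : 0 ≤ δ) (h1 : δ ≤ 1) (j : ℕ) :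
    (1 + δ) ^ j ≤ 1 + j * δ + δ ^ 2 * 4 ^ j := by
  induction j with
  | zero => simp; positivity
  | succ j ih =>
    have hj : (j : ℝ) ≤ 4 ^ j := by exact_mod_cast (Nat.lt_pow_self (by norm_num)).le
    have h4 : (0 : ℝ) ≤ 4 ^ j := by positivity
    have := mul_le_mul_of_nonneg_right ih (by linarith : 0 ≤ 1 + δ)
    rw [pow_succ, pow_succ 4]
    push_cast
    have h2 : δ ^ 2 * j ≤ δ ^ 2 * 4 ^ j := by gcongr
    have h3 : δ ^ 3 * 4 ^ j ≤ δ ^ 2 * 4 ^ j := by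
      gcongr ?_ * _
      exact pow_le_pow_of_le_one h0 h1 (by norm_num)
    nlinarith

/-- If the expected number of exit sites of some finite set is less than one, cluster sizes have
uniformly bounded exponential moments. -/
lemma exists_exponential_moment {p : ℝ} (hp0 : 0 ≤ p) (hp1 : p ≤ 1) {S : Finset Site}
    (hS : (0 : Site) ∈ S) (hφ : bexp p S (fun ω => ((exitSites S 0 ω).card : ℝ)) < 1) :
    ∃ z > (1 : ℝ), ∃ m ≥ (1 : ℝ), ∀ (A : Finset Site) (x : Site),
      bexp p A (fun ω => z ^ (cluster {x} ω).card) ≤ m := by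
  set φ := bexp p S (fun ω => ((exitSites S 0 ω).card : ℝ)) with hφdef
  have hφ0 : 0 ≤ φ := bexp_nonneg hp0 hp1 fun ω _ => by positivity
  set D : ℝ := 4 ^ (S.card * 6) with hD
  have hD1 : 1 ≤ D := one_le_pow₀ (by norm_num)
  set δ := (1 - φ) / (2 * D) with hδ
  have hδ0 : 0 < δ := div_pos (by linarith) (by linarith)
  have hδD : δ * D = (1 - φ) / 2 := by rw [hδ]; field_simp
  have hδ1 : δ ≤ 1 := by nlinarith
  set b := 1 + δ * φ + δ * ((1 - φ) / 2) with hb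
  have hb0 : 0 < b := by
    have : 0 ≤ δ * φ := by positivity
    have : 0 ≤ δ * ((1 - φ) / 2) := mul_nonneg hδ0.le (by linarith)
    linarith
  have hbm : b < 1 + δ := by nlinarith
  have hE : bexp p S (fun ω => (1 + δ) ^ (exitSites S 0 ω).card) ≤ b := by
    calc bexp p S (fun ω => (1 + δ) ^ (exitSites S 0 ω).card)
        ≤ bexp p S (fun ω => (1 + δ * ((1 - φ) / 2)) + δ * ((exitSites S 0 ω).card : ℝ)) := by
          refine bexp_mono hp0 hp1 fun ω _ => ?_
          have h1 := one_add_pow_le hδ0.le hδ1 (exitSites S 0 ω).card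
          have h2 : (4 : ℝ) ^ (exitSites S 0 ω).card ≤ D :=
            pow_le_pow_right₀ (by norm_num) (card_exitSites_le S 0 ω)
          have h3 : δ ^ 2 * 4 ^ (exitSites S 0 ω).card ≤ δ ^ 2 * D := by gcongr
          have h4 : δ ^ 2 * D = δ * ((1 - φ) / 2) := by rw [sq, mul_assoc, hδD]
          linarith
      _ = b := by rw [bexp_add, bexp_const, bexp_const_mul, hb]; ring
  have hS0 : S.card ≠ 0 := Finset.card_ne_zero_of_mem hS
  have hq : 1 < (1 + δ) / b := (one_lt_div hb0).2 hbm
  refine ⟨((1 + δ) / b) ^ ((S.card : ℝ)⁻¹), Real.one_lt_rpow hq (by positivity), 1 + δ,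
    by linarith, fun A x => ?_⟩
  have := bexp_pow_card_cluster_le hp0 hp1
    (Real.one_le_rpow hq.le (by positivity : 0 ≤ (S.card : ℝ)⁻¹)) (by linarith : 1 ≤ 1 + δ) hS
    ?_ A {x}
  · simpa using this
  · rw [Real.rpow_inv_natCast_pow (by linarith) hS0]
    calc (1 + δ) / b * bexp p S (fun ω => (1 + δ) ^ (exitSites S 0 ω).card)
        ≤ (1 + δ) / b * b := by gcongr
      _ = 1 + δ := by field_simp

end ExponentialMoment

/-! ### A differential inequality for the one-arm probability -/

section OneArm

open Classical in
/-- The sites of `Λ` that are joined to `T` by an open path. -/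
noncomputable def reached (Λ : Finset Site) (T : Set Site) (ω : Finset Site) : Finset Site :=
  cluster (Λ.filter (· ∈ T)) (ω ∩ Λ)

lemma mem_reached {Λ ω : Finset Site} {T : Set Site} {v : Site} :
    v ∈ reached Λ T ω ↔ ∃ u ∈ T, Linked (↑(ω ∩ Λ) : Set Site) u v := by
  classical
  rw [reached, mem_cluster]
  refine exists_congr fun u => ⟨fun h => ⟨(Finset.mem_filter.1 h.1).2, h.2⟩, fun h =>
    ⟨Finset.mem_filter.2 ⟨?_, h.1⟩, h.2⟩⟩
  have := h.2.left_mem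
  rw [Finset.mem_coe, Finset.mem_inter] at this
  exact this.2

lemma reached_mono (Λ : Finset Site) (T : Set Site) : Monotone (reached Λ T) := by
  intro ω ω' h
  exact cluster_mono (Finset.inter_subset_inter_right h)

lemma reach_iff_mem_reached {Λ ω : Finset Site} {T : Set Site} {x : Site} :
    Reach Λ {x} T ω ↔ x ∈ reached Λ T ω := by
  simp only [Reach, Set.mem_singleton_iff, exists_eq_left, mem_reached]
  exact exists_congr fun v => and_congr_right fun _ => ⟨Linked.symm, Linked.symm⟩

open Classical in
/-- The sites of `Λ` whose state is not revealed when `reached Λ T ω` is explored from `T`. -/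
noncomputable def unexplored (Λ : Finset Site) (T : Set Site) (ω : Finset Site) : Finset Site :=
  Λ.filter fun v => v ∉ T ∧ v ∉ reached Λ T ω ∧ ∀ u ∈ reached Λ T ω, ¬ triAdj u v

lemma mem_unexplored {Λ ω : Finset Site} {T : Set Site} {v : Site} : v ∈ unexplored Λ T ω ↔
    v ∈ Λ ∧ v ∉ T ∧ v ∉ reached Λ T ω ∧ ∀ u ∈ reached Λ T ω, ¬ triAdj u v := by
  simp [unexplored]

lemma mem_reached_of_mem {Λ ω : Finset Site} {T : Set Site} {v : Site} (hv : v ∈ ω)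
    (hvΛ : v ∈ Λ) (h : v ∉ unexplored Λ T ω) : v ∈ reached Λ T ω := by
  have hv' : v ∈ (↑(ω ∩ Λ) : Set Site) := by simp [hv, hvΛ]
  rw [mem_unexplored] at h
  by_contra hU
  have : v ∉ T := fun hT => hU (mem_reached.2 ⟨v, hT, Linked.refl hv'⟩)
  refine h ⟨hvΛ, this, hU, fun u hu huv => hU ?_⟩
  obtain ⟨t, ht, htu⟩ := mem_reached.1 hu
  exact mem_reached.2 ⟨t, ht, htu.tail huv hv'⟩

/-- The unexplored region is determined by the states of the explored sites. -/
lemma unexplored_eq_iff {Λ ω S : Finset Site} {T : Set Site} :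
    unexplored Λ T ω = S ↔ unexplored Λ T (ω ∩ (Λ \ S)) = S := by
  set ω' := ω ∩ (Λ \ S) with hω'
  have hmono : reached Λ T ω' ⊆ reached Λ T ω := reached_mono Λ T Finset.inter_subset_left
  suffices h : unexplored Λ T ω = S ∨ unexplored Λ T ω' = S →
      reached Λ T ω ⊆ reached Λ T ω' by
    have key (h : reached Λ T ω ⊆ reached Λ T ω') : unexplored Λ T ω = unexplored Λ T ω' := by
      ext v
      rw [mem_unexplored, mem_unexplored, subset_antisymm h hmono]
    exact ⟨fun hS => key (h (Or.inl hS)) ▸ hS, fun hS => (key (h (Or.inr hS))).trans hS⟩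
  intro h v hv
  have hmem {w : Site} (hw : w ∈ reached Λ T ω) (hS : w ∉ S) :
      w ∈ (↑(ω' ∩ Λ) : Set Site) := by
    have := (cluster_subset _ _ hw : w ∈ ω ∩ Λ)
    rw [Finset.mem_inter] at this
    simp [hω', this.1, this.2, hS]
  obtain ⟨u, hu, huω, huv⟩ := mem_reached.1 hv
  clear hv
  induction huv with
  | refl =>
    have hu' : u ∈ reached Λ T ω := mem_reached.2 ⟨u, hu, Linked.refl huω⟩
    refine mem_reached.2 ⟨u, hu, Linked.refl (hmem hu' fun hS => ?_)⟩
    rcases h with h | h <;> rw [← h, mem_unexplored] at hS <;> exact hS.2.1 hu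
  | @tail b c h1 h2 ih =>
    have hc : c ∈ reached Λ T ω := mem_reached.2 ⟨u, hu, huω, h1.tail h2⟩
    obtain ⟨t, ht, htb⟩ := mem_reached.1 ih
    refine mem_reached.2 ⟨t, ht, htb.tail h2.1 (hmem hc fun hS => ?_)⟩
    rcases h with h | h <;> rw [← h, mem_unexplored] at hS
    · exact hS.2.2.1 hc
    · exact hS.2.2.2 b ih h2.1

/-- Closed sites that are pivotal for the connection of `x` to `T`. -/
lemma pivotal_of_mem_exitSites {Λ ω : Finset Site} {T : Set Site} {x y : Site}
    (hexit : ∀ w ∈ Λ, ∀ w' ∉ Λ, triAdj w w' → w ∈ T)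
    (hy : y ∈ exitSites (unexplored Λ T ω) x ω) :
    y ∈ Λ ∧ y ∉ ω ∧ Reach Λ {x} T (insert y ω) := by
  obtain ⟨hyS, v, hv, hvy⟩ := mem_exitSites.1 hy
  have hvS : v ∈ unexplored Λ T ω := by
    have := hv.right_mem
    rw [Finset.mem_coe, Finset.mem_inter] at this
    exact this.2
  obtain ⟨hvΛ, hvT, hvU, hvN⟩ := mem_unexplored.1 hvS
  have hyΛ : y ∈ Λ := by
    by_contra h
    exact hvT (hexit v hvΛ y h hvy)
  have hyU : y ∉ reached Λ T ω := fun h => hvN y h (triAdj_symm hvy)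
  refine ⟨hyΛ, fun h => hyU (mem_reached_of_mem h hyΛ hyS), ?_⟩
  have hsub : (↑(ω ∩ Λ) : Set Site) ⊆ ↑(insert y ω ∩ Λ) :=
    Finset.coe_subset.2 (Finset.inter_subset_inter_right (Finset.subset_insert _ _))
  have hy' : y ∈ (↑(insert y ω ∩ Λ) : Set Site) := by simp [hyΛ]
  have hxy : Linked (↑(insert y ω ∩ Λ) : Set Site) x y := by
    refine (hv.mono ?_).tail hvy hy'
    refine subset_trans (Finset.coe_subset.2 (Finset.inter_subset_inter_left ?_)) hsub
    intro w hw
    exact (mem_unexplored.1 hw).1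
  by_cases hyT : y ∈ T
  · exact ⟨x, rfl, y, hyT, hxy⟩
  · rw [mem_unexplored] at hyS
    push Not at hyS
    obtain ⟨u, hu, huy⟩ := hyS hyΛ hyT hyU
    obtain ⟨t, ht, htu⟩ := mem_reached.1 hu
    exact ⟨x, rfl, t, ht, hxy.trans ((htu.mono hsub).tail huy hy').symm⟩

lemma pivotal_self {Λ ω : Finset Site} {T : Set Site} {x : Site} (hx : x ∈ Λ)
    (hS : x ∉ unexplored Λ T ω) (hU : ¬ Reach Λ {x} T ω) :
    x ∉ ω ∧ Reach Λ {x} T (insert x ω) := by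
  rw [reach_iff_mem_reached] at hU
  refine ⟨fun h => hU (mem_reached_of_mem h hx hS), ?_⟩
  have hx' : x ∈ (↑(insert x ω ∩ Λ) : Set Site) := by simp [hx]
  by_cases hxT : x ∈ T
  · exact ⟨x, rfl, x, hxT, Linked.refl hx'⟩
  · rw [mem_unexplored] at hS
    push Not at hS
    obtain ⟨u, hu, hux⟩ := hS hx hxT hU
    obtain ⟨t, ht, htu⟩ := mem_reached.1 hu
    refine ⟨x, rfl, t, ht, ((htu.mono ?_).tail hux hx').symm⟩
    exact Finset.coe_subset.2 (Finset.inter_subset_inter_right (Finset.subset_insert _ _))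

lemma card_le_sum_pivotal {Λ ω : Finset Site} {T : Set Site} {x : Site}
    {E : Finset Site} (hE : ∀ y ∈ E, y ∈ Λ ∧ y ∉ ω ∧ Reach Λ {x} T (insert y ω))
    (h : ¬ Reach Λ {x} T ω) :
    (E.card : ℝ) ≤
      ∑ y ∈ Λ, (ind (Reach Λ {x} T (insert y ω)) - ind (Reach Λ {x} T (ω.erase y))) := by
  calc (E.card : ℝ) = ∑ y ∈ E, 1 := by simp
    _ = ∑ y ∈ E, (ind (Reach Λ {x} T (insert y ω)) - ind (Reach Λ {x} T (ω.erase y))) := by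
        refine Finset.sum_congr rfl fun y hy => ?_
        obtain ⟨-, h2, h3⟩ := hE y hy
        rw [ind_of h3, Finset.erase_eq_of_notMem h2, ind_of_not h, sub_zero]
    _ ≤ _ := Finset.sum_le_sum_of_subset_of_nonneg (fun y hy => (hE y hy).1) fun y _ _ =>
        sub_nonneg.2 (ind_mono (Reach.monotone _ _ _
          ((Finset.erase_subset _ _).trans (Finset.subset_insert _ _))))

/-- If every finite set has at least one expected exit site, the derivative of the one-arm
probability is at least the probability of the complement. -/
lemma one_sub_le_sum_pivotal {p : ℝ} (hp0 : 0 ≤ p) (hp1 : p ≤ 1) {Λ : Finset Site} {T : Set Site}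
    {x : Site} (hx : x ∈ Λ) (hexit : ∀ w ∈ Λ, ∀ w' ∉ Λ, triAdj w w' → w ∈ T)
    (hS : ∀ S : Finset Site, x ∈ S → 1 ≤ bexp p S fun ω => ((exitSites S x ω).card : ℝ)) :
    1 - bprob p Λ (Reach Λ {x} T) ≤ ∑ y ∈ Λ, bexp p Λ fun ω =>
      ind (Reach Λ {x} T (insert y ω)) - ind (Reach Λ {x} T (ω.erase y)) := by
  classical
  set 𝒮 := Λ.powerset.filter (x ∈ ·) with h𝒮
  have hnot {ω : Finset Site} (h : x ∈ unexplored Λ T ω) : ¬ Reach Λ {x} T ω :=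
    fun hR => (mem_unexplored.1 h).2.2.1 (reach_iff_mem_reached.1 hR)
  have hUmem {ω : Finset Site} (h : x ∈ unexplored Λ T ω) : unexplored Λ T ω ∈ 𝒮 :=
    Finset.mem_filter.2 ⟨Finset.mem_powerset.2 fun v hv => (mem_unexplored.1 hv).1, h⟩
  have hprod (S : Finset Site) (hSm : S ∈ 𝒮) :
      bexp p Λ (fun ω => ind (unexplored Λ T ω = S)) ≤
      bexp p Λ (fun ω => ind (unexplored Λ T ω = S) * ((exitSites S x ω).card : ℝ)) := by
    obtain ⟨hSΛ, hxS⟩ := Finset.mem_filter.1 hSm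
    have hloc (ω : Finset Site) : ind (unexplored Λ T ω = S) =
        ind (unexplored Λ T (ω ∩ (Λ \ S)) = S) := congrArg ind (propext unexplored_eq_iff)
    rw [bexp_mul_of_disjoint p Finset.sdiff_subset (Finset.mem_powerset.1 hSΛ)
      Finset.sdiff_disjoint hloc (fun ω => by rw [exitSites_inter subset_rfl]),
      bexp_local p Finset.sdiff_subset hloc]
    exact le_mul_of_one_le_right (bexp_nonneg hp0 hp1 fun _ _ => ind_nonneg _) (hS S hxS)
  calc 1 - bprob p Λ (Reach Λ {x} T)
      = bexp p Λ (fun ω => ind (¬ Reach Λ {x} T ω)) := (bprob_not _ _ _).symm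
    _ ≤ bexp p Λ (fun ω => ∑ S ∈ 𝒮, ind (unexplored Λ T ω = S) +
          ind (x ∉ unexplored Λ T ω ∧ ¬ Reach Λ {x} T ω)) := by
        refine bexp_mono hp0 hp1 fun ω _ => ?_
        have h0 : 0 ≤ ∑ S ∈ 𝒮, ind (unexplored Λ T ω = S) :=
          Finset.sum_nonneg fun _ _ => ind_nonneg _
        by_cases hxS : x ∈ unexplored Λ T ω
        · have h1 := Finset.single_le_sum (f := fun S => ind (unexplored Λ T ω = S))
            (fun S _ => ind_nonneg _) (hUmem hxS)
          simp only [ind_of] at h1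
          have h2 := ind_nonneg (x ∉ unexplored Λ T ω ∧ ¬ Reach Λ {x} T ω)
          have h3 := ind_le_one (¬ Reach Λ {x} T ω)
          linarith
        · have := ind_mono (P := ¬ Reach Λ {x} T ω)
            (Q := x ∉ unexplored Λ T ω ∧ ¬ Reach Λ {x} T ω) fun h => ⟨hxS, h⟩
          linarith
    _ ≤ bexp p Λ (fun ω => ∑ S ∈ 𝒮,
          ind (unexplored Λ T ω = S) * ((exitSites S x ω).card : ℝ) +
          ind (x ∉ unexplored Λ T ω ∧ ¬ Reach Λ {x} T ω)) := by
        rw [bexp_add, bexp_add, bexp_sum, bexp_sum]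
        exact add_le_add_left (Finset.sum_le_sum hprod) _
    _ ≤ bexp p Λ (fun ω => ∑ y ∈ Λ,
          (ind (Reach Λ {x} T (insert y ω)) - ind (Reach Λ {x} T (ω.erase y)))) := by
        refine bexp_mono hp0 hp1 fun ω _ => ?_
        by_cases hxS : x ∈ unexplored Λ T ω
        · rw [ind_of_not (fun h => h.1 hxS), add_zero, Finset.sum_eq_single_of_mem _ (hUmem hxS)
            fun S _ hne => by rw [ind_of_not hne.symm, zero_mul], ind_of rfl, one_mul]
          exact card_le_sum_pivotal
            (fun y hy => pivotal_of_mem_exitSites hexit hy) (hnot hxS)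
        · rw [Finset.sum_eq_zero fun S hSm => by
            rw [ind_of_not (fun h : unexplored Λ T ω = S => hxS (h ▸ (Finset.mem_filter.1 hSm).2)),
              zero_mul], zero_add]
          by_cases hR : Reach Λ {x} T ω
          · rw [ind_of_not (fun h => h.2 hR)]
            exact Finset.sum_nonneg fun y _ => sub_nonneg.2 (ind_mono (Reach.monotone _ _ _
              ((Finset.erase_subset _ _).trans (Finset.subset_insert _ _))))
          · rw [ind_of ⟨hxS, hR⟩]
            have := card_le_sum_pivotal (E := {x}) (fun y hy => by
              rw [Finset.mem_singleton] at hy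
              subst hy
              exact ⟨hx, pivotal_self hx hxS hR⟩) hR
            simpa using this
    _ = _ := bexp_sum _ _ _ _

/-- If every finite set has at least one expected exit site at `p`, then the one-arm probabilities
at `q > p` are bounded below. -/
lemma sub_le_bprob_reach {p q : ℝ} (hp0 : 0 ≤ p) (hpq : p < q) (hq1 : q ≤ 1)
    {Λ : Finset Site} {T : Set Site}
    {x : Site} (hx : x ∈ Λ) (hexit : ∀ w ∈ Λ, ∀ w' ∉ Λ, triAdj w w' → w ∈ T)
    (hS : ∀ S : Finset Site, x ∈ S → 1 ≤ bexp p S fun ω => ((exitSites S x ω).card : ℝ)) :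
    (q - p) / 2 ≤ bprob q Λ (Reach Λ {x} T) := by
  set θ := fun s => bprob s Λ (Reach Λ {x} T) with hθ
  have hd (s : ℝ) := hasDerivAt_bexp s Λ fun ω => ind (Reach Λ {x} T ω)
  obtain ⟨s, hs, hslope⟩ := exists_hasDerivAt_eq_slope θ _ hpq
    (fun s _ => (hd s).continuousAt.continuousWithinAt) fun s _ => hd s
  have hs0 : 0 ≤ s := hp0.trans hs.1.le
  have hs1 : s ≤ 1 := hs.2.le.trans hq1
  have h1 := one_sub_le_sum_pivotal hs0 hs1 hx hexit fun S hxS => (hS S hxS).trans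
    (bexp_le_bexp_of_le hp0 hs.1.le hs1 S fun ω ω' h =>
      Nat.cast_le.2 (Finset.card_le_card (exitSites_mono S x h)))
  rw [hslope, le_div_iff₀ (sub_pos.2 hpq)] at h1
  have h2 : θ s ≤ θ q := bprob_le_bprob_of_le hs0 hs.2.le hq1 Λ (Reach.monotone _ _ _)
  have h3 : 0 ≤ θ p := bprob_nonneg hp0 (hpq.le.trans hq1) _ _
  change (1 - θ s) * (q - p) ≤ θ q - θ p at h1
  change (q - p) / 2 ≤ θ q
  nlinarith

end OneArm

/-! ### Connections from a large box to the boundary of a larger box -/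

section BoxToFrame

lemma exists_forall_sub_le {u : ℕ → ℝ} (n₀ : ℕ) (h0 : ∀ n, 0 ≤ u n) {δ : ℝ} (hδ : 0 < δ) :
    ∃ r ≥ n₀, ∀ n ≥ r, u r - u n ≤ δ := by
  have hb : BddBelow (Set.range fun i => u (n₀ + i)) := ⟨0, by rintro _ ⟨i, rfl⟩; exact h0 _⟩
  obtain ⟨i, hi⟩ := exists_lt_of_ciInf_lt (lt_add_of_pos_right (⨅ i, u (n₀ + i)) hδ)
  refine ⟨n₀ + i, by omega, fun n hn => ?_⟩
  have := ciInf_le hb (n - n₀)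
  rw [Nat.add_sub_cancel' (by omega)] at this
  linarith

lemma reach_center_of_le {n n' : ℕ} (h : n ≤ n') {x : Site} {ω : Finset Site}
    (hR : Reach (ball x n') {x} (frame x n') ω) : Reach (ball x n) {x} (frame x n) ω := by
  refine hR.restrict ?_ ?_ fun w hw w' hw' => mem_frame_of_exit hw hw'
  · simp [mem_ball]
  · rintro v ⟨hv, hv'⟩
    rw [Finset.mem_coe, mem_ball] at hv'
    rw [mem_frame] at hv ⊢
    omega

lemma bprob_reach_center (p : ℝ) {x : Site} {n : ℕ} {Λ : Finset Site} (h : ball x n ⊆ Λ) :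
    bprob p Λ (Reach (ball x n) {x} (frame x n)) =
      bprob p (ball 0 n) (Reach (ball 0 n) {0} (frame 0 n)) := by
  rw [Reach.bprob_ambient p h,
    ← Reach.bprob_map p (Equiv.addRight x) (triAdj_addRight x) (ball 0 n) (ball 0 n) {0}]
  rw [ball_map_addRight, frame_image_addRight, Set.image_singleton]
  simp only [Equiv.coe_addRight, zero_add]

lemma reach_ball_of_le {k n n' : ℕ} (hk : k ≤ n) (h : n ≤ n') {ω : Finset Site}
    (hR : Reach (ball 0 n') ↑(ball 0 k) (frame 0 n') ω) :
    Reach (ball 0 n) ↑(ball 0 k) (frame 0 n) ω := by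
  refine hR.restrict ?_ ?_ fun w hw w' hw' => mem_frame_of_exit hw hw'
  · intro v hv
    simp only [Finset.mem_coe, mem_ball] at hv ⊢
    omega
  · rintro v ⟨hv, hv'⟩
    rw [Finset.mem_coe, mem_ball] at hv'
    rw [mem_frame] at hv ⊢
    omega

/-- If points are joined to distance `n` with probability bounded below, then a large box is
joined to distance `n` with probability close to one, uniformly in `n`. -/
lemma exists_one_sub_le_bprob_reach_ball {q c : ℝ} (hq0 : 0 ≤ q) (hq1 : q ≤ 1) (hc : 0 < c)
    (hθ : ∀ n, c ≤ bprob q (ball 0 n) (Reach (ball 0 n) {0} (frame 0 n))) {ε : ℝ}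
    (hε : 0 < ε) : ∃ k, ∀ n ≥ k,
      1 - ε ≤ bprob q (ball 0 n) (Reach (ball 0 n) ↑(ball 0 k) (frame 0 n)) := by
  set θ := fun n => bprob q (ball 0 n) (Reach (ball 0 n) {0} (frame 0 n)) with hθdef
  have hθ1 (n : ℕ) : θ n ≤ 1 := bprob_le_one hq0 hq1 _ _
  obtain ⟨m, hm⟩ := exists_pow_lt_of_lt_one (half_pos hε) (sub_lt_self 1 hc)
  have hsub {x : Site} {i j : ℕ} (h : i ≤ j) : ball x i ⊆ ball x j := fun v hv => by
    rw [mem_ball] at *; omega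
  obtain ⟨r, -, hr⟩ := exists_forall_sub_le (u := θ) 0 (fun n => bprob_nonneg hq0 hq1 _ _)
    (show 0 < ε / (2 * (m + 1)) by positivity)
  set k := m * (2 * r + 1) + r + 1 with hk
  refine ⟨k, fun n hn => ?_⟩
  set x : ℕ → Site := fun i => (((i * (2 * r + 1) : ℕ) : ℤ), 0) with hx
  have hx1 (i : ℕ) (hi : i ∈ Finset.range m) : i * (2 * r + 1) + r < k := by
    have := Nat.mul_le_mul_right (2 * r + 1) (Finset.mem_range.1 hi).le
    omega
  set A : ℕ → Finset Site → Prop := fun i => Reach (ball (x i) r) {x i} (frame (x i) r) with hA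
  set B : ℕ → Finset Site → Prop :=
    fun i => Reach (ball (x i) (n + k)) {x i} (frame (x i) (n + k)) with hB
  set Λ := ball 0 (n + 2 * k) with hΛ
  have hball {i : ℕ} (hi : i ∈ Finset.range m) {j : ℕ} (hj : j ≤ n + k) :
      ball (x i) j ⊆ Λ := fun v hv => by
    have := hx1 i hi
    simp only [hΛ, hx, mem_ball, Prod.fst_zero, Prod.snd_zero] at hv ⊢
    omega
  have hBG {i : ℕ} (hi : i ∈ Finset.range m) {ω : Finset Site} (h : B i ω) :
      Reach (ball 0 n) ↑(ball 0 k) (frame 0 n) ω := by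
    have := hx1 i hi
    have h' : Reach (ball 0 n) {x i} (frame 0 n) ω := by
      refine h.restrict ?_ ?_ fun w hw w' hw' => mem_frame_of_exit hw hw'
      · simp only [hx, Set.singleton_subset_iff, Finset.mem_coe, mem_ball, Prod.fst_zero,
          Prod.snd_zero]
        omega
      · rintro v ⟨hv, hv'⟩
        simp only [hx, Finset.mem_coe, mem_ball, mem_frame, Prod.fst_zero, Prod.snd_zero]
          at hv hv' ⊢
        omega
    refine h'.mono subset_rfl ?_ subset_rfl subset_rfl
    simp only [hx, Set.singleton_subset_iff, Finset.mem_coe, mem_ball, Prod.fst_zero,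
      Prod.snd_zero]
    omega
  have hAprob {i : ℕ} (hi : i ∈ Finset.range m) : bprob q Λ (A i) = θ r :=
    bprob_reach_center q (hball hi (by omega))
  have hnoA : bprob q Λ (fun ω => ∀ i ∈ Finset.range m, ¬ A i ω) ≤ ε / 2 := by
    rw [bprob_forall_of_disjoint q _ (fun i => ball (x i) r) (fun i hi => hball hi (by omega))
      ?_ (fun i ω => ¬ A i ω) fun i _ ω => not_congr (Reach.inter_iff subset_rfl)]
    · calc ∏ i ∈ Finset.range m, bprob q Λ (fun ω => ¬ A i ω)
          ≤ ∏ i ∈ Finset.range m, (1 - c) :=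
            Finset.prod_le_prod (fun i _ => bprob_nonneg hq0 hq1 _ _) fun i hi => by
              rw [bprob_not, hAprob hi]
              linarith [hθ r]
        _ ≤ ε / 2 := by simpa using hm.le
    · intro i _ j _ hij
      refine Finset.disjoint_left.2 fun v hv hv' => ?_
      simp only [hx, mem_ball] at hv hv'
      rcases lt_or_gt_of_ne hij with h | h
      · have := Nat.mul_le_mul_right (2 * r + 1) (Nat.succ_le_of_lt h)
        rw [Nat.succ_mul] at this
        omega
      · have := Nat.mul_le_mul_right (2 * r + 1) (Nat.succ_le_of_lt h)
        rw [Nat.succ_mul] at this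
        omega
  have hAB : bprob q Λ (fun ω => ∃ i ∈ Finset.range m, A i ω ∧ ¬ B i ω) ≤ ε / 2 := by
    refine (bprob_exists_le hq0 hq1 _ _ _).trans ?_
    calc ∑ i ∈ Finset.range m, bprob q Λ (fun ω => A i ω ∧ ¬ B i ω)
        ≤ ∑ i ∈ Finset.range m, ε / (2 * (m + 1)) := Finset.sum_le_sum fun i hi => by
          rw [bprob_and_not q Λ fun ω _ => reach_center_of_le (by omega), hAprob hi,
            bprob_reach_center q (hball hi le_rfl)]
          exact hr (n + k) (by omega)
      _ = ε / 2 * (m / (m + 1)) := by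
          rw [Finset.sum_const, Finset.card_range, nsmul_eq_mul]
          field_simp
      _ ≤ ε / 2 := mul_le_of_le_one_right (half_pos hε).le
          ((div_le_one (by positivity)).2 (by linarith))
  have key : bprob q Λ (fun ω => ¬ Reach (ball 0 n) ↑(ball 0 k) (frame 0 n) ω) ≤ ε := by
    refine (bprob_mono hq0 hq1 (Q := fun ω => (∀ i ∈ Finset.range m, ¬ A i ω) ∨
      ∃ i ∈ Finset.range m, A i ω ∧ ¬ B i ω) fun ω _ hG => ?_).trans
      ((bprob_or_le hq0 hq1 _ _ _).trans (by linarith))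
    by_contra! h
    obtain ⟨⟨i, hi, hAi⟩, h⟩ := h
    exact hG (hBG hi (h i hi hAi))
  rw [bprob_not, Reach.bprob_ambient q (hsub (by omega))] at key
  linarith

end BoxToFrame

/-! ### Arms from a box to a prescribed side of a larger box -/

section Arms

/-- At least `m` sites of `T` are joined to `B` by open paths in `D`. -/
def ManyReach (D : Finset Site) (B T : Set Site) (m : ℕ) (ω : Finset Site) : Prop :=
  ∃ F : Finset Site, F.card = m ∧ ∀ v ∈ F, v ∈ T ∧ Reach D B {v} ω

namespace ManyReach

variable {D ω : Finset Site} {B T : Set Site} {m : ℕ}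

lemma monotone (D : Finset Site) (B T : Set Site) (m : ℕ) : Monotone (ManyReach D B T m) :=
  fun _ _ hω ⟨F, hF, h⟩ => ⟨F, hF, fun v hv => ⟨(h v hv).1, Reach.monotone _ _ _ hω (h v hv).2⟩⟩

lemma map (e : Site ≃ Site) (he : ∀ u v, triAdj u v → triAdj (e u) (e v))
    (h : ManyReach D B T m ω) :
    ManyReach (D.map e.toEmbedding) (e '' B) (e '' T) m (ω.map e.toEmbedding) := by
  obtain ⟨F, hF, h⟩ := h
  refine ⟨F.map e.toEmbedding, by rw [Finset.card_map, hF], fun w hw => ?_⟩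
  obtain ⟨v, hv, rfl⟩ := Finset.mem_map.1 hw
  refine ⟨Set.mem_image_of_mem e (h v hv).1, ?_⟩
  have := (h v hv).2.map e he
  rwa [Set.image_singleton] at this

lemma bprob_map (p : ℝ) (e : Site ≃ Site) (he : ∀ u v, triAdj (e u) (e v) ↔ triAdj u v)
    (Λ D : Finset Site) (B T : Set Site) (m : ℕ) :
    bprob p (Λ.map e.toEmbedding) (ManyReach (D.map e.toEmbedding) (e '' B) (e '' T) m) =
      bprob p Λ (ManyReach D B T m) := by
  rw [_root_.bprob_map]
  refine bprob_congr p fun ω _ => ⟨fun h => ?_, fun h => h.map e fun u v => (he u v).2⟩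
  have := h.map e.symm fun u v h => (he _ _).1 (by simpa using h)
  simpa [Finset.map_map, ← Equiv.trans_toEmbedding, Set.image_image] using this

end ManyReach

/-- If few boundary sites of `D` are joined to `B`, the connection is likely to reach no further. -/
lemma bprob_few_mul_le {p : ℝ} (hp0 : 0 ≤ p) (hp1 : p ≤ 1) {D D' : Finset Site}
    {B T T' : Set Site} (hD : D ⊆ D') (hB : B ⊆ D)
    (hexit : ∀ w ∈ D, ∀ w' ∉ D, triAdj w w' → w ∈ T) (hT : Disjoint T' D) (s : ℕ) :
    bprob p D (fun ω => Reach D B T ω ∧ ¬ ManyReach D B T s ω) * (1 - p) ^ (s * 6) ≤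
      bprob p D' (fun ω => Reach D B T ω ∧ ¬ Reach D' B T' ω) := by
  classical
  have hp : 0 ≤ 1 - p := by linarith
  have e := bexp_union p (Finset.disjoint_sdiff : Disjoint D (D' \ D))
    fun ω => ind (Reach D B T ω ∧ ¬ Reach D' B T' ω)
  rw [Finset.union_sdiff_of_subset hD] at e
  rw [mul_comm, bprob, ← bexp_const_mul, bprob, e]
  refine bexp_mono hp0 hp1 fun η hη => ?_
  by_cases h : Reach D B T η ∧ ¬ ManyReach D B T s η
  swap
  · rw [ind_of_not h, mul_zero]
    exact bexp_nonneg hp0 hp1 fun _ _ => ind_nonneg _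
  obtain ⟨hR, hM⟩ := h
  rw [ind_of ⟨hR, hM⟩, mul_one]
  set H := (reached D B η).filter (· ∈ T) with hH
  have hHs : H.card ≤ s := by
    by_contra! hlt
    obtain ⟨F, hFH, hF⟩ := Finset.exists_subset_card_eq hlt.le
    refine hM ⟨F, hF, fun v hv => ?_⟩
    obtain ⟨h1, h2⟩ := Finset.mem_filter.1 (hFH hv)
    obtain ⟨u, hu, huv⟩ := mem_reached.1 h1
    exact ⟨h2, u, hu, v, rfl, huv⟩
  calc (1 - p) ^ (s * 6) ≤ (1 - p) ^ (H.biUnion nbrs).card :=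
        pow_le_pow_of_le_one hp (by linarith) ((Finset.card_biUnion_le_card_mul _ _ _
          fun v _ => card_nbrs_le v).trans (Nat.mul_le_mul_right _ hHs))
    _ ≤ bprob p (D' \ D) fun ζ => Disjoint ζ (H.biUnion nbrs) :=
        pow_le_bprob_disjoint hp0 hp1 _ _
    _ ≤ _ := bexp_mono hp0 hp1 fun ζ hζ => ind_mono fun hdisj =>
        ⟨Reach.monotone _ _ _ Finset.subset_union_left hR, ?_⟩
  rintro ⟨u, hu, v, hv, huv⟩
  have hsub : (↑((η ∪ ζ) ∩ D') : Set Site) ∩ ↑D ⊆ ↑(η ∩ D) := by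
    intro w hw
    simp only [Finset.coe_inter, Finset.coe_union, Set.mem_inter_iff, Set.mem_union,
      Finset.mem_coe] at hw ⊢
    rcases hw.1.1 with h | h
    · exact ⟨h, hw.2⟩
    · exact absurd hw.2 (Finset.mem_sdiff.1 (hζ h)).2
  rcases huv.exit (hB hu) with h | ⟨w, w', hww, h, hw'D, hw'⟩
  · exact Set.disjoint_left.1 hT hv h.right_mem.2
  · have hwH : w ∈ H := Finset.mem_filter.2
      ⟨mem_reached.2 ⟨u, hu, h.mono hsub⟩, hexit w h.right_mem.2 w' hw'D hww⟩
    have hw'ζ : w' ∈ ζ := by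
      simp only [Finset.coe_inter, Finset.coe_union, Set.mem_inter_iff, Set.mem_union,
        Finset.mem_coe] at hw'
      exact hw'.1.resolve_left fun h => hw'D (hη h)
    exact Finset.disjoint_left.1 hdisj hw'ζ (Finset.mem_biUnion.2 ⟨w, hwH, mem_nbrs.2 hww⟩)

/-- The number of boundary sites joined to a given box is unbounded. -/
lemma exists_bprob_manyReach {q ε : ℝ} (hq0 : 0 ≤ q) (hq1 : q < 1) (hε : 0 < ε) {k : ℕ}
    (hk : ∀ n ≥ k, 1 - ε ≤ bprob q (ball 0 n) (Reach (ball 0 n) ↑(ball 0 k) (frame 0 n)))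
    (s n₀ : ℕ) : ∃ n ≥ n₀, k ≤ n ∧
      bprob q (ball 0 n) (fun ω => ¬ ManyReach (ball 0 n) ↑(ball 0 k) (frame 0 n) s ω) ≤
        2 * ε := by
  have h1q : 0 < 1 - q := by linarith
  obtain ⟨n, hn, h⟩ := exists_forall_sub_le (max n₀ k)
    (u := fun n => bprob q (ball 0 n) (Reach (ball 0 n) ↑(ball 0 k) (frame 0 n)))
    (fun n => bprob_nonneg hq0 hq1.le _ _) (show 0 < ε * (1 - q) ^ (s * 6) by positivity)
  have hkn : k ≤ n := (le_max_right _ _).trans hn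
  refine ⟨n, (le_max_left _ _).trans hn, hkn, ?_⟩
  have hD : ball 0 n ⊆ ball 0 (n + 1) := fun v hv => by rw [mem_ball] at *; omega
  have hB : (ball 0 k : Set Site) ⊆ ball 0 n := fun v hv => by
    rw [Finset.mem_coe, mem_ball] at *; omega
  have h2 := bprob_few_mul_le hq0 hq1.le hD hB (T := frame 0 n) (T' := frame 0 (n + 1))
    (fun w hw w' hw' => mem_frame_of_exit hw hw') (Set.disjoint_left.2 fun v hv hv' => by
      rw [Finset.mem_coe, mem_ball] at hv'
      rw [mem_frame] at hv
      omega) s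
  rw [bprob_and_not q _ fun ω _ => reach_ball_of_le hkn n.le_succ,
    Reach.bprob_ambient q hD] at h2
  have h3 := le_of_mul_le_mul_right (h2.trans (h (n + 1) n.le_succ)) (by positivity)
  have h4 := hk n hkn
  have h5 := bprob_not q (ball 0 n) (Reach (ball 0 n) ↑(ball 0 k) (frame 0 n))
  refine (bprob_mono hq0 hq1.le (Q := fun ω => (Reach (ball 0 n) ↑(ball 0 k) (frame 0 n) ω ∧
    ¬ ManyReach (ball 0 n) ↑(ball 0 k) (frame 0 n) s ω) ∨
    ¬ Reach (ball 0 n) ↑(ball 0 k) (frame 0 n) ω) fun ω _ h => ?_).trans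
    ((bprob_or_le hq0 hq1.le _ _ _).trans (by linarith))
  tauto

lemma ball_zero_image_neg (k : ℕ) :
    Equiv.neg Site '' (ball 0 k : Set Site) = (ball 0 k : Set Site) := by
  rw [← Equiv.coe_toEmbedding, ← Finset.coe_map, ball_map_neg, neg_zero]

lemma ball_zero_image_swap (k : ℕ) :
    Equiv.prodComm ℤ ℤ '' (ball 0 k : Set Site) = (ball 0 k : Set Site) := by
  rw [← Equiv.coe_toEmbedding, ← Finset.coe_map, ball_map_swap, Prod.swap_zero]

lemma image_neg_fst (c : ℤ) : Equiv.neg Site '' {v | v.1 = c} = {v | v.1 = -c} := by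
  ext v
  rw [Equiv.image_eq_preimage_symm]
  simp [neg_eq_iff_eq_neg]

lemma image_neg_snd (c : ℤ) : Equiv.neg Site '' {v | v.2 = c} = {v | v.2 = -c} := by
  ext v
  rw [Equiv.image_eq_preimage_symm]
  simp [neg_eq_iff_eq_neg]

lemma image_swap_fst (c : ℤ) : Equiv.prodComm ℤ ℤ '' {v | v.1 = c} = {v | v.2 = c} := by
  ext v
  rw [Equiv.image_eq_preimage_symm]
  simp

/-- The square root trick for the four sides of a box. -/
lemma bprob_not_manyReach_side_pow_le {q : ℝ} (hq0 : 0 ≤ q) (hq1 : q ≤ 1) (n k m : ℕ) :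
    bprob q (ball 0 n) (fun ω => ¬ ManyReach (ball 0 n) ↑(ball 0 k) {v | v.1 = n} m ω) ^ 4 ≤
      bprob q (ball 0 n)
        (fun ω => ¬ ManyReach (ball 0 n) ↑(ball 0 k) (frame 0 n) (4 * m) ω) := by
  classical
  set E : Set Site → Finset Site → Prop := fun T => ManyReach (ball 0 n) ↑(ball 0 k) T m with hE
  have hmono (T : Set Site) : Monotone (E T) := ManyReach.monotone _ _ _ _
  have hneg (T : Set Site) : bprob q (ball 0 n) (E (Equiv.neg Site '' T)) =
      bprob q (ball 0 n) (E T) := by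
    have := ManyReach.bprob_map q (Equiv.neg Site) triAdj_neg (ball 0 n) (ball 0 n) (ball 0 k) T m
    rwa [ball_map_neg, neg_zero, ball_zero_image_neg] at this
  have hswap (T : Set Site) : bprob q (ball 0 n) (E (Equiv.prodComm ℤ ℤ '' T)) =
      bprob q (ball 0 n) (E T) := by
    have := ManyReach.bprob_map q (Equiv.prodComm ℤ ℤ) triAdj_swap (ball 0 n) (ball 0 n)
      (ball 0 k) T m
    rwa [ball_map_swap, Prod.swap_zero, ball_zero_image_swap] at this
  have hL := hneg {v | v.1 = (n : ℤ)}
  have hT := hswap {v | v.1 = (n : ℤ)}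
  have hB := hneg {v | v.2 = (n : ℤ)}
  rw [image_neg_fst] at hL
  rw [image_swap_fst] at hT
  rw [image_neg_snd, hT] at hB
  set x := bprob q (ball 0 n) (fun ω => ¬ E {v | v.1 = (n : ℤ)} ω) with hx
  have hor {P Q : Finset Site → Prop} (hP : Monotone P) (hQ : Monotone Q) :
      Monotone fun ω => P ω ∨ Q ω := fun a b hab h => h.imp (hP hab) (hQ hab)
  have h12 := bprob_not_mul_le hq0 hq1 (ball 0 n) (hmono {v | v.1 = (n : ℤ)})
    (hmono {v | v.1 = -(n : ℤ)})
  have h34 := bprob_not_mul_le hq0 hq1 (ball 0 n) (hmono {v | v.2 = (n : ℤ)})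
    (hmono {v | v.2 = -(n : ℤ)})
  have h := bprob_not_mul_le hq0 hq1 (ball 0 n)
    (hor (hmono {v | v.1 = (n : ℤ)}) (hmono {v | v.1 = -(n : ℤ)}))
    (hor (hmono {v | v.2 = (n : ℤ)}) (hmono {v | v.2 = -(n : ℤ)}))
  have e (T : Set Site) (hT : bprob q (ball 0 n) (E T) =
      bprob q (ball 0 n) (E {v | v.1 = (n : ℤ)})) : bprob q (ball 0 n) (fun ω => ¬ E T ω) = x := by
    rw [hx, bprob_not, bprob_not, hT]
  rw [e _ hL, ← hx] at h12
  rw [e _ hT, e _ hB] at h34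
  have hx0 : 0 ≤ x := bprob_nonneg hq0 hq1 _ _
  calc x ^ 4 = (x * x) * (x * x) := by ring
    _ ≤ _ := mul_le_mul h12 h34 (by positivity) (bprob_nonneg hq0 hq1 _ _)
    _ ≤ _ := h
    _ ≤ _ := bprob_mono hq0 hq1 fun ω _ hno ⟨F, hF, hFr⟩ => hno ?_
  obtain ⟨cut, hcut⟩ : ∃ cut : Set Site → Finset Site, ∀ T v, v ∈ cut T ↔ v ∈ F ∧ v ∈ T :=
    ⟨fun T => F.filter (· ∈ T), fun T v => Finset.mem_filter⟩
  have hside (T : Set Site) (h : m ≤ (cut T).card) : E T ω := by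
    obtain ⟨F', hF', hcard⟩ := Finset.exists_subset_card_eq h
    exact ⟨F', hcard, fun v hv => ⟨((hcut T v).1 (hF' hv)).2,
      (hFr v ((hcut T v).1 (hF' hv)).1).2⟩⟩
  by_contra! hcon
  have hlt (T : Set Site) (h : ¬ E T ω) : (cut T).card < m :=
    not_le.1 fun h' => h (hside T h')
  have hsub : F ⊆ (cut {v | v.1 = (n : ℤ)} ∪ cut {v | v.1 = -(n : ℤ)}) ∪
      (cut {v | v.2 = (n : ℤ)} ∪ cut {v | v.2 = -(n : ℤ)}) := by
    intro v hv
    have := (hFr v hv).1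
    simp only [mem_frame, Prod.fst_zero, Prod.snd_zero, zero_add, zero_sub] at this
    rw [Finset.mem_union, Finset.mem_union, Finset.mem_union, hcut, hcut, hcut, hcut]
    rcases this with h | h | h | h
    · exact Or.inl (Or.inl ⟨hv, h⟩)
    · exact Or.inl (Or.inr ⟨hv, h⟩)
    · exact Or.inr (Or.inl ⟨hv, h⟩)
    · exact Or.inr (Or.inr ⟨hv, h⟩)
  have h1 := (Finset.card_le_card hsub).trans ((Finset.card_union_le _ _).trans
    (add_le_add (Finset.card_union_le _ _) (Finset.card_union_le _ _)))
  have h2 := hlt _ hcon.1.1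
  have h3 := hlt _ hcon.1.2
  have h4 := hlt _ hcon.2.1
  have h5 := hlt _ hcon.2.2
  omega

end Arms

section Extension

/-- The box `{-n, …, n}²`, prolonged by `L` columns on the right. -/
noncomputable def rect (n L : ℕ) : Finset Site :=
  Finset.Icc (-(n : ℤ)) (n + L) ×ˢ Finset.Icc (-(n : ℤ)) n

lemma mem_rect {n L : ℕ} {v : Site} :
    v ∈ rect n L ↔ -(n : ℤ) ≤ v.1 ∧ v.1 ≤ n + L ∧ -(n : ℤ) ≤ v.2 ∧ v.2 ≤ n := by
  simp [rect, Finset.mem_product, and_assoc]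

lemma ball_subset_rect (n L : ℕ) : ball 0 n ⊆ rect n L := fun v hv => by
  simp only [mem_ball, mem_rect, Prod.fst_zero, Prod.snd_zero] at *
  omega

/-- The row segment of length `L` to the right of `(n, j)`. -/
noncomputable def rowSegment (n L : ℕ) (j : ℤ) : Finset Site :=
  Finset.Icc ((n : ℤ) + 1) (n + L) ×ˢ {j}

lemma mem_rowSegment {n L : ℕ} {j : ℤ} {v : Site} :
    v ∈ rowSegment n L j ↔ (n : ℤ) + 1 ≤ v.1 ∧ v.1 ≤ n + L ∧ v.2 = j := by
  simp only [rowSegment, Finset.mem_product, Finset.mem_Icc, Finset.mem_singleton, and_assoc]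

lemma card_rowSegment (n L : ℕ) (j : ℤ) : (rowSegment n L j).card = L := by
  simp [rowSegment]

lemma linked_rowSegment {n L : ℕ} {A : Set Site} {u v : Site} (hv : v.1 = n) (h : Linked A u v)
    (hA : (rowSegment n L v.2 : Set Site) ⊆ A) : Linked A u (n + L, v.2) := by
  suffices ∀ i : ℕ, i ≤ L → Linked A u (n + i, v.2) from this L le_rfl
  intro i hi
  induction i with
  | zero =>
    rw [show (((n : ℤ) + (0 : ℕ), v.2) : Site) = v from Prod.ext (by simp [hv]) rfl]
    exact h
  | succ i ih =>
    refine (ih (by omega)).tail ?_ (hA ?_)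
    · rw [triAdj_iff]
      push_cast
      omega
    · rw [Finset.mem_coe, mem_rowSegment]
      push_cast
      omega

lemma bprob_manyReach_mul_le {q : ℝ} (hq0 : 0 ≤ q) (hq1 : q ≤ 1) (n L m : ℕ) (B : Set Site) :
    bprob q (ball 0 n) (ManyReach (ball 0 n) B {v | v.1 = n} m) * (1 - (1 - q ^ L) ^ m) ≤
      bprob q (rect n L) (Reach (rect n L) B {v | v.1 = n + L}) := by
  have hqL : q ^ L ≤ 1 := pow_le_one₀ hq0 hq1
  have hDR := ball_subset_rect n L
  have e := bexp_union q (Finset.disjoint_sdiff : Disjoint (ball 0 n) (rect n L \ ball 0 n))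
    fun ω => ind (Reach (rect n L) B {v | v.1 = n + L} ω)
  rw [Finset.union_sdiff_of_subset hDR] at e
  rw [mul_comm, bprob, ← bexp_const_mul, bprob, e]
  refine bexp_mono hq0 hq1 fun η hη => ?_
  by_cases h : ManyReach (ball 0 n) B {v | v.1 = n} m η
  swap
  · rw [ind_of_not h, mul_zero]
    exact bexp_nonneg hq0 hq1 fun _ _ => ind_nonneg _
  rw [ind_of h, mul_one]
  obtain ⟨F, rfl, hF⟩ := h
  have hF1 {v : Site} (hv : v ∈ F) : v.1 = n := (hF v hv).1
  have hF2 {v : Site} (hv : v ∈ F) : v ∈ ball 0 n := by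
    obtain ⟨-, u, -, w, hw, h⟩ := hF v hv
    have := h.right_mem
    rw [Set.mem_singleton_iff.1 hw, Finset.mem_coe, Finset.mem_inter] at this
    exact this.2
  have hseg {v : Site} (hv : v ∈ F) : rowSegment n L v.2 ⊆ rect n L \ ball 0 n := fun w hw => by
    have := hF2 hv
    rw [mem_rowSegment] at hw
    simp only [Finset.mem_sdiff, mem_rect, mem_ball, Prod.fst_zero, Prod.snd_zero] at this ⊢
    omega
  have hnone : bprob q (rect n L \ ball 0 n) (fun ζ => ∀ v ∈ F, ¬ rowSegment n L v.2 ⊆ ζ) ≤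
      (1 - q ^ L) ^ F.card := by
    rw [bprob_forall_of_disjoint q F (fun v => rowSegment n L v.2) (fun v hv => hseg hv) ?_
      (fun v ζ => ¬ rowSegment n L v.2 ⊆ ζ) fun v _ ζ => by
        simp [Finset.subset_inter_iff]]
    · rw [← Finset.prod_const]
      refine Finset.prod_le_prod (fun v _ => bprob_nonneg hq0 hq1 _ _) fun v hv => ?_
      have := pow_le_bprob_subset hq0 hq1 (hseg hv)
      rw [card_rowSegment] at this
      rw [bprob_not]
      linarith
    · intro v hv w hw hvw
      refine Finset.disjoint_left.2 fun z hz hz' => hvw ?_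
      rw [mem_rowSegment] at hz hz'
      exact Prod.ext ((hF1 hv).trans (hF1 hw).symm) (hz.2.2.symm.trans hz'.2.2)
  have hsome : 1 - (1 - q ^ L) ^ F.card ≤ bprob q (rect n L \ ball 0 n)
      (fun ζ => ¬ ∀ v ∈ F, ¬ rowSegment n L v.2 ⊆ ζ) := by
    rw [bprob_not]
    linarith
  refine hsome.trans (bexp_mono hq0 hq1 fun ζ _ => ind_mono fun h => ?_)
  push Not at h
  obtain ⟨v, hv, hvζ⟩ := h
  obtain ⟨-, u, hu, w, hw, h⟩ := hF v hv
  rw [Set.mem_singleton_iff.1 hw] at h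
  refine ⟨u, hu, _, rfl, linked_rowSegment (hF1 hv) (h.mono ?_) ?_⟩
  · exact Finset.coe_subset.2 (Finset.inter_subset_inter Finset.subset_union_left hDR)
  · exact Finset.coe_subset.2 (Finset.subset_inter (hvζ.trans Finset.subset_union_right)
      ((hseg hv).trans Finset.sdiff_subset))

/-- If points are joined to distance `n` with probability bounded below, then every box of a
suitable size inside any given region is likely to be joined to the right side of a larger box. -/
lemma exists_arms {q c : ℝ} (hq0 : 0 < q) (hq1 : q < 1) (hc : 0 < c)
    (hθ : ∀ n, c ≤ bprob q (ball 0 n) (Reach (ball 0 n) {0} (frame 0 n))) :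
    ∃ k : ℕ, ∀ R : ℕ, ∃ N ≥ k + R, ∀ x ∈ ball 0 R,
      7 / 8 ≤ bprob q (ball 0 N) (Reach (ball 0 N) ↑(ball x k) {v | v.1 = N}) := by
  obtain ⟨k, hk⟩ := exists_one_sub_le_bprob_reach_ball hq0.le hq1.le hc hθ
    (show (0 : ℝ) < (1 / 16) ^ 4 / 2 by norm_num)
  refine ⟨k, fun R => ?_⟩
  obtain ⟨m, hm⟩ := exists_pow_lt_of_lt_one (show (0 : ℝ) < 1 / 16 by norm_num)
    (sub_lt_self 1 (pow_pos hq0 (2 * R)))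
  obtain ⟨n, -, hkn, hn⟩ := exists_bprob_manyReach hq0.le hq1 (by norm_num) hk (4 * m) 0
  have hside := (bprob_not_manyReach_side_pow_le hq0.le hq1.le n k m).trans hn
  rw [mul_div_cancel₀ _ two_ne_zero, pow_le_pow_iff_left₀
    (bprob_nonneg hq0.le hq1.le _ _) (by norm_num) four_ne_zero, bprob_not] at hside
  refine ⟨n + R, by omega, fun x hx => ?_⟩
  simp only [mem_ball, Prod.fst_zero, Prod.snd_zero] at hx
  obtain ⟨L, hL⟩ : ∃ L : ℕ, (L : ℤ) = R - x.1 := ⟨(R - x.1).toNat, by omega⟩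
  have hpow : (1 - q ^ L) ^ m ≤ 1 / 16 := by
    refine (pow_le_pow_left₀ ?_ ?_ m).trans hm.le
    · linarith [pow_le_one₀ hq0.le hq1.le (n := L)]
    · linarith [pow_le_pow_of_le_one hq0.le hq1.le (show L ≤ 2 * R by omega)]
  have hext := bprob_manyReach_mul_le hq0.le hq1.le n L m ↑(ball 0 k)
  have hsub : (rect n L).map (Equiv.addRight x).toEmbedding ⊆ ball 0 (n + R) := fun v hv => by
    rw [Finset.mem_map_equiv] at hv
    simp only [mem_rect, mem_ball, Equiv.addRight_symm, Equiv.coe_addRight, Prod.fst_add,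
      Prod.snd_add, Prod.fst_neg, Prod.snd_neg, Prod.fst_zero, Prod.snd_zero] at hv ⊢
    omega
  rw [← Reach.bprob_map q (Equiv.addRight x) (triAdj_addRight x),
    ← Reach.bprob_ambient q hsub] at hext
  have hfinal := hext.trans (bprob_mono hq0.le hq1.le fun ω _ h => h.mono hsub
    (B' := ↑(ball x k)) (T' := {v | v.1 = ((n + R : ℕ) : ℤ)}) ?_ ?_ subset_rfl)
  · refine le_trans ?_ hfinal
    calc (7 / 8 : ℝ) ≤ (15 / 16) * (15 / 16) := by norm_num
      _ ≤ _ := mul_le_mul (by linarith) (by linarith) (by norm_num)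
        (bprob_nonneg hq0.le hq1.le _ _)
  · rw [← Equiv.coe_toEmbedding, ← Finset.coe_map, ball_map_addRight, zero_add]
  · rintro _ ⟨v, hv, rfl⟩
    rw [Set.mem_ofPred_eq] at hv ⊢
    rw [Equiv.coe_addRight, Prod.fst_add, hv]
    push_cast
    omega

end Extension

/-! ### Planarity -/

section Planarity

/-- The signed number of times the step from `a` to `b` crosses, above `w`, from the column
of `w` to the next one. -/
def flux (a b w : Site) : ℤ :=
  if a.1 = w.1 ∧ b.1 = w.1 + 1 ∧ w.2 < a.2 then 1
  else if b.1 = w.1 ∧ a.1 = w.1 + 1 ∧ w.2 < b.2 then -1 else 0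

/-- The indicator of `a` lying strictly above `w`, in the same column. -/
def above (w a : Site) : ℤ := if a.1 = w.1 ∧ w.2 < a.2 then 1 else 0

/-- The indicator of `a` lying in a column strictly to the right of `w`. -/
def rightOf (w a : Site) : ℤ := if w.1 < a.1 then 1 else 0

lemma flux_sub_flux {a b w w' : Site} (hab : triAdj a b) (ha : a ≠ w) (ha' : a ≠ w') (hb : b ≠ w)
    (hb' : b ≠ w') (e1 : w'.1 = w.1 + 1) (e2 : w'.2 = w.2 ∨ w'.2 = w.2 + 1) :
    flux a b w - flux a b w' = above w' b - above w' a := by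
  have hadj := triAdj_iff.1 hab
  rw [ne_eq, Prod.ext_iff] at ha ha' hb hb'
  obtain ⟨a1, a2⟩ := a
  obtain ⟨b1, b2⟩ := b
  obtain ⟨x, y⟩ := w
  obtain ⟨x', y'⟩ := w'
  simp only at *
  subst e1
  simp only [flux, above]
  rcases hadj with ⟨rfl, rfl⟩ | ⟨rfl, rfl⟩ | ⟨rfl, rfl⟩ | ⟨rfl, rfl⟩ | ⟨rfl, rfl⟩ | ⟨rfl, rfl⟩ <;>
    rcases e2 with rfl | rfl <;> split_ifs <;> omega

/-- The signed number `h w` of crossings above `w` of a path from `u` to `v` in `A`. -/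
lemma exists_flux {A : Set Site} {n : ℤ} (hA : ∀ a ∈ A, -n ≤ a.2 ∧ a.2 ≤ n) {u v : Site}
    (huv : Linked A u v) : ∃ h : Site → ℤ,
      (∀ w w', w ∉ A → w' ∉ A → w'.1 = w.1 → w'.2 = w.2 + 1 → h w = h w') ∧
      (∀ w w', w ∉ A → w' ∉ A → w'.1 = w.1 + 1 → w'.2 = w.2 ∨ w'.2 = w.2 + 1 →
        h w - h w' = above w' v - above w' u) ∧
      (∀ w, n ≤ w.2 → h w = 0) ∧
      ∀ w ∉ A, w.2 = -n → h w = rightOf w v - rightOf w u := by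
  obtain ⟨hu, huv⟩ := huv
  have hne {a w : Site} (ha : a ∈ A) (hw : w ∉ A) : a ≠ w := fun h => hw (h ▸ ha)
  have ne {a w : Site} (ha : a ∈ A) (hw : w ∉ A) : ¬ (a.1 = w.1 ∧ a.2 = w.2) := fun h =>
    hne ha hw (Prod.ext h.1 h.2)
  have hmem : v ∈ A := Linked.right_mem ⟨hu, huv⟩
  induction huv with
  | refl => exact ⟨fun _ => 0, by simp, by simp, by simp, by simp⟩
  | @tail a b hua hab ih =>
    have ha : a ∈ A := Linked.right_mem ⟨hu, hua⟩
    obtain ⟨h, h1, h2, h3, h4⟩ := ih ha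
    have hadj := triAdj_iff.1 hab.1
    have ha' := hA a ha
    have hb' := hA b hmem
    refine ⟨fun w => h w + flux a b w, fun w w' hw hw' e1 e2 => ?_,
      fun w w' hw hw' e1 e2 => ?_, fun w e => ?_, fun w hw e => ?_⟩
    · have := h1 w w' hw hw' e1 e2
      have := ne ha hw
      have := ne ha hw'
      have := ne hmem hw
      have := ne hmem hw'
      simp only [flux]
      split_ifs <;> omega
    · have := h2 w w' hw hw' e1 e2
      have := flux_sub_flux hab.1 (hne ha hw) (hne ha hw') (hne hmem hw) (hne hmem hw') e1 e2
      simp only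
      omega
    · have := h3 w e
      simp only [flux]
      split_ifs <;> omega
    · have := h4 w hw e
      have := ne ha hw
      have := ne hmem hw
      simp only [flux, rightOf] at *
      split_ifs at * <;> omega

/-- A left-right crossing and a top-bottom crossing of the same box share a site. -/
lemma not_disjoint_of_crossings {n : ℕ} {A B : Set Site} (hA : A ⊆ ball 0 n) (hB : B ⊆ ball 0 n)
    {u v u' v' : Site} (huv : Linked A u v) (hu : u.1 = -n) (hv : v.1 = n)
    (huv' : Linked B u' v') (hu' : u'.2 = n) (hv' : v'.2 = -n) : ¬ Disjoint A B := by
  intro hAB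
  have hball {C : Set Site} (hC : C ⊆ ball 0 n) {a : Site} (ha : a ∈ C) :
      -(n : ℤ) ≤ a.1 ∧ a.1 ≤ n ∧ -(n : ℤ) ≤ a.2 ∧ a.2 ≤ n := by
    have := mem_ball.1 (Finset.mem_coe.1 (hC ha))
    simp only [Prod.fst_zero, Prod.snd_zero] at this
    omega
  obtain ⟨z, hz⟩ : ∃ z : Site, z = ((n : ℤ) + 1, v.2) := ⟨_, rfl⟩
  have hz1 : z.1 = n + 1 := by rw [hz]
  have hz2 : z.2 = v.2 := by rw [hz]
  have hvA := hball hA huv.right_mem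
  have huz : Linked (insert z A) u z := (huv.mono (Set.subset_insert z A)).tail
    (triAdj_iff.2 (by omega)) (Set.mem_insert z A)
  obtain ⟨h, h1, h2, h3, h4⟩ := exists_flux (n := n) (fun a ha => by
    rcases ha with rfl | ha
    · omega
    · exact (hball hA ha).2.2) huz
  have hBA {b : Site} (hb : b ∈ B) : b ∉ insert z A := by
    rintro (rfl | ha)
    · have := hball hB hb
      omega
    · exact Set.disjoint_left.1 hAB ha hb
  have hstep {a b : Site} (ha : a ∈ B) (hb : b ∈ B) (e : b.1 = a.1 + 1)
      (e' : b.2 = a.2 ∨ b.2 = a.2 + 1) : h a = h b := by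
    have := h2 a b (hBA ha) (hBA hb) e e'
    have := hball hB ha
    have := hball hB hb
    simp only [above] at *
    split_ifs at * <;> omega
  have hconst : h u' = h v' := by
    obtain ⟨hu'B, huv'⟩ := huv'
    clear hv'
    induction huv' with
    | refl => rfl
    | @tail a b hua hab ih =>
      rw [ih]
      have ha : a ∈ B := Linked.right_mem ⟨hu'B, hua⟩
      have hb : b ∈ B := hab.2
      rcases triAdj_iff.1 hab.1 with e | e | e | e | e | e
      · exact (hstep hb ha e.1 (.inl e.2)).symm
      · exact hstep ha hb (by omega) (.inl e.2.symm)
      · exact (h1 b a (hBA hb) (hBA ha) e.1 e.2).symm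
      · exact h1 a b (hBA ha) (hBA hb) e.1.symm (by omega)
      · exact (hstep hb ha e.1 (.inr e.2)).symm
      · exact hstep ha hb (by omega) (.inr (by omega))
  have e3 := h3 u' hu'.ge
  have e4 := h4 v' (hBA huv'.right_mem) hv'
  have := hball hB huv'.right_mem
  simp only [rightOf] at e4
  split_ifs at e4 <;> omega

end Planarity

/-! ### Pivotal blocks -/

section Pivotal

variable {V : Type*} [DecidableEq V]

lemma exists_pivotal {P : Finset V → Prop} {ω β : Finset V} (h : P (ω ∪ β)) (h' : ¬ P ω) :
    ∃ η ⊆ β, ∃ y ∈ β, y ∉ η ∧ P (insert y (ω ∪ η)) ∧ ¬ P (ω ∪ η) := by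
  induction β using Finset.induction_on with
  | empty => exact absurd (by simpa using h) h'
  | insert x β hx ih =>
    by_cases hβ : P (ω ∪ β)
    · obtain ⟨η, hη, y, hy, H⟩ := ih hβ
      exact ⟨η, hη.trans (Finset.subset_insert x β), y, Finset.mem_insert_of_mem hy, H⟩
    · exact ⟨β, Finset.subset_insert x β, x, Finset.mem_insert_self x β, hx,
        by rwa [← Finset.union_insert], hβ⟩

/-- If the state of a block `β` decides an increasing event with some probability, then the sites
of `β` contribute proportionally to Russo's formula. -/
lemma bprob_pivotal_mul_le {c s : ℝ} (hc : 0 ≤ c) (hcs : c ≤ s) (hsc : s ≤ 1 - c)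
    {P : Finset V → Prop} (hP : Monotone P) {β Λ : Finset V} (hβ : β ⊆ Λ) :
    bprob s Λ (fun ω => P (ω ∪ β) ∧ ¬ P (ω \ β)) * c ^ β.card ≤
      ∑ y ∈ β, bexp s Λ fun ω => ind (P (insert y ω)) - ind (P (ω.erase y)) := by
  have hs0 : 0 ≤ s := hc.trans hcs
  have hs1 : s ≤ 1 := by linarith
  have hdiff (ω : Finset V) (y : V) : 0 ≤ ind (P (insert y ω)) - ind (P (ω.erase y)) :=
    sub_nonneg.2 (ind_mono (hP ((Finset.erase_subset y ω).trans (Finset.subset_insert y ω))))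
  have e := bexp_union s (Finset.sdiff_disjoint : Disjoint (Λ \ β) β)
  rw [Finset.sdiff_union_of_subset hβ] at e
  rw [← bexp_sum, mul_comm, bprob, ← bexp_const_mul, e, e]
  refine bexp_mono hs0 hs1 fun ω hω => ?_
  have hωβ : Disjoint ω β := Finset.disjoint_of_subset_left hω Finset.sdiff_disjoint
  have hleft : bexp s β (fun η => c ^ β.card * ind (P (ω ∪ η ∪ β) ∧ ¬ P ((ω ∪ η) \ β))) =
      c ^ β.card * ind (P (ω ∪ β) ∧ ¬ P ω) := by
    rw [← bexp_const s β (c ^ β.card * ind (P (ω ∪ β) ∧ ¬ P ω))]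
    refine bexp_congr s fun η hη => ?_
    rw [Finset.union_assoc, Finset.union_eq_right.2 hη, Finset.union_sdiff_distrib,
      Finset.sdiff_eq_empty_iff_subset.2 hη, Finset.union_empty, hωβ.sdiff_eq_left]
  rw [hleft]
  by_cases h : P (ω ∪ β) ∧ ¬ P ω
  swap
  · rw [ind_of_not h, mul_zero]
    exact bexp_nonneg hs0 hs1 fun η _ => Finset.sum_nonneg fun y _ => hdiff _ y
  rw [ind_of h, mul_one]
  obtain ⟨η, hη, y, hy, hyη, h1, h2⟩ := exists_pivotal h.1 h.2
  refine le_trans ?_ (weight_mul_le_bexp hs0 hs1 hη fun η _ =>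
    Finset.sum_nonneg fun y _ => hdiff (ω ∪ η) y)
  have hone : 1 ≤ ∑ y ∈ β, (ind (P (insert y (ω ∪ η))) - ind (P ((ω ∪ η).erase y))) := by
    refine le_trans ?_ (Finset.single_le_sum (fun y _ => hdiff (ω ∪ η) y) hy)
    have : y ∉ ω ∪ η := by
      simp [hyη, Finset.disjoint_right.1 hωβ hy]
    rw [Finset.erase_eq_of_notMem this, ind_of h1, ind_of_not h2, sub_zero]
  calc c ^ β.card = c ^ η.card * c ^ (β \ η).card := by
        rw [← pow_add, add_comm, Finset.card_sdiff_add_card_eq_card hη]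
    _ ≤ s ^ η.card * (1 - s) ^ (β \ η).card := by
        have : c ≤ 1 - s := by linarith
        have : 0 ≤ 1 - s := by linarith
        gcongr
    _ ≤ _ := le_mul_of_one_le_right
        (mul_nonneg (pow_nonneg hs0 _) (pow_nonneg (by linarith) _)) hone

/-- A block that decides an increasing event uniformly over the parameters in `[c, 1/2]` cannot
be repeated too often. -/
lemma card_mul_le_one {ι : Type*} {c : ℝ} (hc : 0 ≤ c) (hc2 : c < 1 / 2) {P : Finset V → Prop}
    (hP : Monotone P) {Λ : Finset V} {K : ℕ} (I : Finset ι) (β : ι → Finset V)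
    (hβ : ∀ i ∈ I, β i ⊆ Λ) (hK : ∀ i ∈ I, (β i).card = K)
    (hdisj : (I : Set ι).PairwiseDisjoint β)
    (hpiv : ∀ i ∈ I, ∀ s, c ≤ s → s ≤ 1 / 2 →
      1 / 2 ≤ bprob s Λ fun ω => P (ω ∪ β i) ∧ ¬ P (ω \ β i)) :
    I.card * (1 / 2 * c ^ K) * (1 / 2 - c) ≤ 1 := by
  obtain ⟨s, ⟨hs0, hs1⟩, hs⟩ := exists_hasDerivAt_eq_slope (fun s => bprob s Λ P) _ hc2
    (fun s _ => (hasDerivAt_bexp s Λ fun ω => ind (P ω)).continuousAt.continuousWithinAt)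
    fun s _ => hasDerivAt_bexp s Λ fun ω => ind (P ω)
  have hs0' : 0 ≤ s := hc.trans hs0.le
  have hs1' : s ≤ 1 := by linarith
  have hlow : I.card * (1 / 2 * c ^ K) ≤
      ∑ y ∈ Λ, bexp s Λ fun ω => ind (P (insert y ω)) - ind (P (ω.erase y)) := by
    classical
    calc I.card * (1 / 2 * c ^ K) = ∑ i ∈ I, 1 / 2 * c ^ K := by
          rw [Finset.sum_const, nsmul_eq_mul]
      _ ≤ ∑ i ∈ I, ∑ y ∈ β i, bexp s Λ fun ω => ind (P (insert y ω)) - ind (P (ω.erase y)) := by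
          refine Finset.sum_le_sum fun i hi => ?_
          have := bprob_pivotal_mul_le hc hs0.le (by linarith) hP (hβ i hi)
          rw [hK i hi] at this
          exact (mul_le_mul_of_nonneg_right (hpiv i hi s hs0.le hs1.le)
            (pow_nonneg hc K)).trans this
      _ = ∑ y ∈ I.biUnion β, bexp s Λ fun ω => ind (P (insert y ω)) - ind (P (ω.erase y)) :=
          (Finset.sum_biUnion hdisj).symm
      _ ≤ _ := by
          refine Finset.sum_le_sum_of_subset_of_nonneg (Finset.biUnion_subset.2 hβ)
            fun y _ _ => bexp_nonneg hs0' hs1' fun ω _ => sub_nonneg.2 (ind_mono (hP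
              ((Finset.erase_subset y ω).trans (Finset.subset_insert y ω))))
  rw [hs] at hlow
  have hpos : 0 < 1 / 2 - c := by linarith
  rw [le_div_iff₀ hpos] at hlow
  have h1 := bprob_le_one (p := 1 / 2) (by norm_num) (by norm_num) Λ P
  have h2 := bprob_nonneg hc (by linarith) Λ P
  linarith

end Pivotal

/-! ### Subcriticality below one half -/

section Subcritical

/-- If a block inside the box is joined to the left and right sides by open sites, and to the top
and bottom sides by closed sites, then its state decides whether there is a crossing. -/
lemma crossing_pivotal {n k : ℕ} {x : Site} {ω : Finset Site} (hx : ball x k ⊆ ball 0 n)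
    (hR : Reach (ball 0 n) ↑(ball x k) {v | v.1 = n} ω)
    (hL : Reach (ball 0 n) ↑(ball x k) {v | v.1 = -n} ω)
    (hT : Reach (ball 0 n) ↑(ball x k) {v | v.2 = n} (ball 0 n \ ω))
    (hB : Reach (ball 0 n) ↑(ball x k) {v | v.2 = -n} (ball 0 n \ ω)) :
    Reach (ball 0 n) {v | v.1 = -n} {v | v.1 = n} (ω ∪ ball x k) ∧
      ¬ Reach (ball 0 n) {v | v.1 = -n} {v | v.1 = n} (ω \ ball x k) := by
  have key {A : Finset Site} {T T' : Set Site} (hA : ball x k ⊆ A)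
      (h : Reach (ball 0 n) ↑(ball x k) T A) (h' : Reach (ball 0 n) ↑(ball x k) T' A) :
      Reach (ball 0 n) T' T A := by
    obtain ⟨u, hu, v, hv, h⟩ := h
    obtain ⟨u', hu', v', hv', h'⟩ := h'
    exact ⟨v', hv', v, hv, h'.symm.trans ((linked_ball (Finset.coe_subset.2
      (Finset.subset_inter hA hx)) hu' hu).trans h)⟩
  refine ⟨key Finset.subset_union_right (hR.mono subset_rfl subset_rfl subset_rfl
    Finset.subset_union_left) (hL.mono subset_rfl subset_rfl subset_rfl
    Finset.subset_union_left), fun h => ?_⟩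
  have hsub : ball 0 n \ ω ⊆ ball 0 n \ (ω \ ball x k) :=
    Finset.sdiff_subset_sdiff subset_rfl Finset.sdiff_subset
  have hx' : ball x k ⊆ ball 0 n \ (ω \ ball x k) := fun v hv => by
    simp [hx hv, hv]
  obtain ⟨u', hu', v', hv', hw⟩ := key hx' (hB.mono subset_rfl subset_rfl subset_rfl hsub)
    (hT.mono subset_rfl subset_rfl subset_rfl hsub)
  obtain ⟨u, hu, v, hv, hb⟩ := h
  refine not_disjoint_of_crossings (Finset.coe_subset.2 Finset.inter_subset_right)
    (Finset.coe_subset.2 Finset.inter_subset_right) hb hu hv hw hu' hv' ?_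
  rw [Finset.disjoint_coe]
  exact Finset.disjoint_of_subset_left Finset.inter_subset_left
    (Finset.disjoint_of_subset_right Finset.inter_subset_left Finset.disjoint_sdiff)

lemma half_le_bprob_crossing_pivotal {q s : ℝ} (hq : 0 ≤ q) (hqs : q ≤ s) (hsq : s ≤ 1 - q)
    {n k R : ℕ} (hn : k + R ≤ n)
    (harm : ∀ x ∈ ball 0 R,
      7 / 8 ≤ bprob q (ball 0 n) (Reach (ball 0 n) ↑(ball x k) {v | v.1 = n}))
    {x : Site} (hx : x ∈ ball 0 R) :
    1 / 2 ≤ bprob s (ball 0 n) fun ω =>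
      Reach (ball 0 n) {v | v.1 = -n} {v | v.1 = n} (ω ∪ ball x k) ∧
        ¬ Reach (ball 0 n) {v | v.1 = -n} {v | v.1 = n} (ω \ ball x k) := by
  have hs0 : 0 ≤ s := hq.trans hqs
  have hs1 : s ≤ 1 := by linarith
  have hnx : -x ∈ ball 0 R := by
    simp only [mem_ball, Prod.fst_neg, Prod.snd_neg, Prod.fst_zero, Prod.snd_zero] at hx ⊢
    omega
  have hswap {y : Site} (hy : y ∈ ball 0 R) : y.swap ∈ ball 0 R := by
    simp only [mem_ball, Prod.fst_swap, Prod.snd_swap, Prod.fst_zero, Prod.snd_zero] at hy ⊢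
    omega
  have hsub : ball x k ⊆ ball 0 n := fun v hv => by
    simp only [mem_ball, Prod.fst_zero, Prod.snd_zero] at hx hv ⊢
    omega
  have hneg {y : Site} {T : Set Site}
      (h : 7 / 8 ≤ bprob q (ball 0 n) (Reach (ball 0 n) ↑(ball (-y) k) T)) :
      7 / 8 ≤ bprob q (ball 0 n) (Reach (ball 0 n) ↑(ball y k) (Equiv.neg Site '' T)) := by
    rwa [← Reach.bprob_map q (Equiv.neg Site) triAdj_neg, ball_map_neg, neg_zero,
      ← Equiv.coe_toEmbedding, ← Finset.coe_map, ball_map_neg, neg_neg] at h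
  have hR := harm x hx
  have hL := hneg (harm (-x) hnx)
  have hT {y : Site} (hy : y ∈ ball 0 R) : 7 / 8 ≤
      bprob q (ball 0 n) (Reach (ball 0 n) ↑(ball y k) {v | v.2 = n}) := by
    have h := harm _ (hswap hy)
    rwa [← Reach.bprob_map q (Equiv.prodComm ℤ ℤ) triAdj_swap, ball_map_swap, Prod.swap_zero,
      ← Equiv.coe_toEmbedding, ← Finset.coe_map, ball_map_swap, Prod.swap_swap,
      Equiv.coe_toEmbedding, image_swap_fst] at h
  have hB := hneg (hT hnx)
  rw [image_neg_fst] at hL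
  rw [image_neg_snd] at hB
  have hup {T : Set Site} {t : ℝ} (hqt : q ≤ t) (ht : t ≤ 1)
      (h : 7 / 8 ≤ bprob q (ball 0 n) (Reach (ball 0 n) ↑(ball x k) T)) :
      1 - bprob t (ball 0 n) (Reach (ball 0 n) ↑(ball x k) T) ≤ 1 / 8 := by
    have := bprob_le_bprob_of_le hq hqt ht (ball 0 n)
      (Reach.monotone (ball 0 n) ↑(ball x k) T)
    linarith
  have hR' := hup hqs hs1 hR
  have hL' := hup hqs hs1 hL
  have hT' := hup (show q ≤ 1 - s by linarith) (by linarith) (hT hx)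
  have hB' := hup (show q ≤ 1 - s by linarith) (by linarith) hB
  rw [← bprob_compl, ← bprob_not] at hT' hB'
  rw [← bprob_not] at hR' hL'
  have h1 := bprob_or_le hs0 hs1 (ball 0 n)
    (fun ω => ¬ Reach (ball 0 n) ↑(ball x k) {v | v.1 = n} ω)
    (fun ω => ¬ Reach (ball 0 n) ↑(ball x k) {v | v.1 = -n} ω)
  have h2 := bprob_or_le hs0 hs1 (ball 0 n)
    (fun ω => ¬ Reach (ball 0 n) ↑(ball x k) {v | v.2 = n} (ball 0 n \ ω))
    (fun ω => ¬ Reach (ball 0 n) ↑(ball x k) {v | v.2 = -n} (ball 0 n \ ω))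
  have h3 := bprob_or_le hs0 hs1 (ball 0 n)
    (fun ω => ¬ Reach (ball 0 n) ↑(ball x k) {v | v.1 = n} ω ∨
      ¬ Reach (ball 0 n) ↑(ball x k) {v | v.1 = -n} ω)
    (fun ω => ¬ Reach (ball 0 n) ↑(ball x k) {v | v.2 = n} (ball 0 n \ ω) ∨
      ¬ Reach (ball 0 n) ↑(ball x k) {v | v.2 = -n} (ball 0 n \ ω))
  have h4 := bprob_mono hs0 hs1 (Λ := ball 0 n) (P := fun ω => ¬ (
      Reach (ball 0 n) {v | v.1 = -n} {v | v.1 = n} (ω ∪ ball x k) ∧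
        ¬ Reach (ball 0 n) {v | v.1 = -n} {v | v.1 = n} (ω \ ball x k)))
    (Q := fun ω => (¬ Reach (ball 0 n) ↑(ball x k) {v | v.1 = n} ω ∨
      ¬ Reach (ball 0 n) ↑(ball x k) {v | v.1 = -n} ω) ∨
      (¬ Reach (ball 0 n) ↑(ball x k) {v | v.2 = n} (ball 0 n \ ω) ∨
      ¬ Reach (ball 0 n) ↑(ball x k) {v | v.2 = -n} (ball 0 n \ ω))) fun ω _ h => by
    by_contra! hc
    exact h (crossing_pivotal hsub hc.1.1 hc.1.2 hc.2.1 hc.2.2)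
  rw [bprob_not] at h4
  linarith

/-- Below `1/2`, some finite set has fewer than one expected exit site. -/
lemma exists_bexp_exitSites_lt_one {p : ℝ} (hp0 : 0 ≤ p) (hp : p < 1 / 2) :
    ∃ S : Finset Site, 0 ∈ S ∧ bexp p S (fun ω => ((exitSites S 0 ω).card : ℝ)) < 1 := by
  by_contra! hS
  obtain ⟨q, hpq, hq⟩ := exists_between hp
  have hq0 : 0 < q := hp0.trans_lt hpq
  obtain ⟨k, hk⟩ := exists_arms hq0 (by linarith) (show 0 < (q - p) / 2 by linarith) fun n =>
    sub_le_bprob_reach hp0 hpq (by linarith) (Λ := ball 0 n) (T := frame 0 n)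
      (by simp [mem_ball]) (fun w hw w' hw' h => mem_frame_of_exit hw hw' h) hS
  set K := (ball 0 k).card with hK
  have hpos : 0 < 1 / 2 * q ^ K * (1 / 2 - q) := by
    have : 0 < 1 / 2 - q := by linarith
    positivity
  obtain ⟨M, hM⟩ := exists_nat_gt (1 / (1 / 2 * q ^ K * (1 / 2 - q)))
  rw [div_lt_iff₀ hpos] at hM
  obtain ⟨n, hn, harm⟩ := hk (M * (2 * k + 1))
  set x : ℕ → Site := fun i => ((i : ℤ) * (2 * k + 1), 0) with hxdef
  have hx {i : ℕ} (hi : i ∈ Finset.range M) : x i ∈ ball 0 (M * (2 * k + 1)) := by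
    have hi' : (i : ℤ) ≤ M := by exact_mod_cast (Finset.mem_range.1 hi).le
    have : (i : ℤ) * (2 * k + 1) ≤ M * (2 * k + 1) := by gcongr
    have : 0 ≤ (i : ℤ) * (2 * k + 1) := by positivity
    simp only [hxdef, mem_ball, Prod.fst_zero, Prod.snd_zero]
    push_cast
    omega
  have := card_mul_le_one hq0.le hq
    (Reach.monotone (ball 0 n) {v | v.1 = -n} {v | v.1 = n}) (Λ := ball 0 n) (K := K)
    (Finset.range M) (fun i => ball (x i) k)
    (fun i hi v hv => by
      have hxi := hx hi
      simp only [mem_ball, Prod.fst_zero, Prod.snd_zero] at hxi hv ⊢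
      omega)
    (fun i _ => by
      have := ball_map_addRight 0 (x i) k
      rw [zero_add] at this
      rw [← this, Finset.card_map])
    (fun i _ j _ hij => Finset.disjoint_left.2 fun v hv hv' => by
      simp only [hxdef, mem_ball] at hv hv'
      rcases lt_or_gt_of_ne hij with h | h
      · have : ((i : ℤ) + 1) * (2 * k + 1) ≤ j * (2 * k + 1) := by gcongr; exact_mod_cast h
        linarith
      · have : ((j : ℤ) + 1) * (2 * k + 1) ≤ i * (2 * k + 1) := by gcongr; exact_mod_cast h
        linarith)
    fun i hi s hqs hs => half_le_bprob_crossing_pivotal hq0.le hqs (by linarith) hn harm (hx hi)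
  rw [Finset.card_range, mul_assoc] at this
  linarith

end Subcritical

/-! ### Large clusters on the screen -/

section Screen

lemma measure_le_bprob {p : ℝ} (hp0 : 0 ≤ p) (hp1 : p ≤ 1) {μ : Measure Config}
    (hμ : IsBernoulliPercolation p μ) (Λ : Finset Site) (P : Finset Site → Prop) :
    μ {ω | P (Λ.filter fun v => ω v = true)} ≤ ENNReal.ofReal (bprob p Λ P) := by
  classical
  have hcyl {η : Finset Site} (hη : η ⊆ Λ) : μ {ω | ∀ v ∈ Λ, ω v = decide (v ∈ η)} =
      ENNReal.ofReal (p ^ η.card * (1 - p) ^ (Λ \ η).card) := by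
    rw [hμ.2 Λ fun v => decide (v ∈ η)]
    simp only [decide_eq_true_eq]
    rw [Finset.prod_ite, Finset.prod_const, Finset.prod_const, Finset.filter_mem_eq_inter,
      Finset.inter_eq_right.2 hη, Finset.filter_notMem_eq_sdiff, ENNReal.ofReal_mul
      (pow_nonneg hp0 _), ENNReal.ofReal_pow hp0, ENNReal.ofReal_pow (by linarith)]
  calc μ {ω | P (Λ.filter fun v => ω v = true)}
      ≤ μ (⋃ η ∈ Λ.powerset.filter P, {ω | ∀ v ∈ Λ, ω v = decide (v ∈ η)}) := by
        refine measure_mono fun ω hω => Set.mem_iUnion₂.2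
          ⟨Λ.filter fun v => ω v = true, by simpa using hω, fun v hv => ?_⟩
        simp [hv]
    _ ≤ ∑ η ∈ Λ.powerset.filter P, μ {ω | ∀ v ∈ Λ, ω v = decide (v ∈ η)} :=
        measure_biUnion_finset_le _ _
    _ = ∑ η ∈ Λ.powerset.filter P, ENNReal.ofReal (p ^ η.card * (1 - p) ^ (Λ \ η).card) :=
        Finset.sum_congr rfl fun η hη =>
          hcyl (Finset.mem_powerset.1 (Finset.mem_filter.1 hη).1)
    _ = ENNReal.ofReal (∑ η ∈ Λ.powerset.filter P, p ^ η.card * (1 - p) ^ (Λ \ η).card) :=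
        (ENNReal.ofReal_sum_of_nonneg fun η _ =>
          mul_nonneg (pow_nonneg hp0 _) (pow_nonneg (by linarith) _)).symm
    _ = ENNReal.ofReal (bprob p Λ P) := by
        simp only [bprob, bexp, Finset.sum_filter, ind, mul_ite, mul_one, mul_zero]

lemma linked_of_isChain {S : Set Site} {w : Site} (l : List Site) {u : Site}
    (hl : (u :: l).IsChain triAdj) (hS : ∀ v ∈ u :: l, v ∈ S)
    (hw : (u :: l).getLast? = some w) : Linked S u w := by
  induction l generalizing u with
  | nil =>
    obtain rfl : u = w := by simpa using hw
    exact .refl (hS u (by simp))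
  | cons v l ih =>
    rw [List.isChain_cons_cons] at hl
    have hu := hS u (by simp)
    have h := ih hl.2 (fun x hx => hS x (List.mem_cons_of_mem u hx)) (by simpa using hw)
    exact ((Linked.refl hu).tail hl.1 h.left_mem).trans h

lemma ConnectedIn.linked {S : Set Site} (h : ConnectedIn S) {u w : Site} (hu : u ∈ S)
    (hw : w ∈ S) : Linked S u w := by
  obtain ⟨l, hl, hlast, hc, hS⟩ := h u hu w hw
  cases l with
  | nil => simp at hl
  | cons v l =>
    obtain rfl : v = u := by simpa using hl
    exact linked_of_isChain l hc hS hlast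

/-- Markov's inequality for the exponential moments of the cluster sizes. -/
lemma measure_clusterEvent_le {p z m : ℝ} (hp0 : 0 ≤ p) (hp1 : p ≤ 1) (hz : 1 < z)
    (hm : ∀ (A : Finset Site) (x : Site), bexp p A (fun ω => z ^ (cluster {x} ω).card) ≤ m)
    {μ : Measure Config} (hμ : IsBernoulliPercolation p μ) (N : ℕ) {n : ℕ} (hn : 0 < n) :
    μ (ClusterEvent N n) ≤ ENNReal.ofReal (N ^ 2 * m / z ^ n) := by
  set Λ : Finset Site := Finset.Ico 0 (N : ℤ) ×ˢ Finset.Ico 0 (N : ℤ) with hΛ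
  have hzn : 0 < z ^ n := pow_pos (by linarith) n
  have hcluster (x : Site) : bprob p Λ (fun ω => n ≤ (cluster {x} ω).card) ≤ m / z ^ n := by
    rw [le_div_iff₀ hzn, mul_comm, bprob, ← bexp_const_mul]
    refine (bexp_mono hp0 hp1 fun ω _ => ?_).trans (hm Λ x)
    by_cases h : n ≤ (cluster {x} ω).card
    · rw [ind_of h, mul_one]
      exact pow_le_pow_right₀ hz.le h
    · rw [ind_of_not h, mul_zero]
      exact pow_nonneg (by linarith) _
  calc μ (ClusterEvent N n)
      ≤ μ {ω | ∃ x ∈ Λ, n ≤ (cluster {x} (Λ.filter fun v => ω v = true)).card} := by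
        refine measure_mono fun ω hω => ?_
        obtain ⟨S, hS, hnS, hc, hopen⟩ := hω
        have hSΛ : S ⊆ Λ.filter fun v => ω v = true := fun v hv => by
          obtain ⟨h1, h2, h3, h4⟩ := hS (Finset.mem_coe.2 hv)
          simp [hΛ, Finset.mem_product, h1, h2, h3, h4, hopen v hv]
        obtain ⟨x, hx⟩ := Finset.card_pos.1 (hn.trans_le hnS)
        refine ⟨x, (Finset.mem_filter.1 (hSΛ hx)).1,
          hnS.trans (Finset.card_le_card fun w hw => ?_)⟩
        rw [mem_cluster_singleton]
        exact (hc.linked (Finset.mem_coe.2 hx) (Finset.mem_coe.2 hw)).mono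
          (Finset.coe_subset.2 hSΛ)
    _ ≤ ENNReal.ofReal (bprob p Λ fun ω => ∃ x ∈ Λ, n ≤ (cluster {x} ω).card) :=
        measure_le_bprob hp0 hp1 hμ Λ fun ω => ∃ x ∈ Λ, n ≤ (cluster {x} ω).card
    _ ≤ ENNReal.ofReal (N ^ 2 * m / z ^ n) := by
        refine ENNReal.ofReal_le_ofReal ((bprob_exists_le hp0 hp1 Λ Λ _).trans
          ((Finset.sum_le_sum fun x _ => hcluster x).trans_eq ?_))
        rw [Finset.sum_const, hΛ, Finset.card_product, Int.card_Ico, nsmul_eq_mul]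
        simp
        ring

end Screen

/-- Theorem 1, part 3 (false detection): under the pure-noise null hypothesis
(every pixel open with probability `p_out < 1/2`), the probability that the
screen contains a connected set of at least `φ(N)` open pixels is at most
`min {α(N), e^{−C₂ φ(N)}}` for all large `N`. -/
theorem false_detection_bound (pout : ℝ) (h0 : 0 < pout) (h1 : pout < 1 / 2)
    (α : ℕ → ℝ) (hα : ∀ N, α N ∈ Set.Ioo (0 : ℝ) 1)
    (φ : ℕ → ℕ) (hφN : ∀ N, φ N ≤ N)
    (hφ : Filter.Tendsto (fun N => (φ N : ℝ) / Real.log N) Filter.atTop Filter.atTop)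
    (hαφ : Filter.Tendsto (fun N => Real.log (1 / α N) / (φ N : ℝ))
      Filter.atTop (nhds 0)) :
    ∃ C₂ > (0 : ℝ), ∃ N₀ : ℕ, ∀ N : ℕ, N₀ ≤ N →
      ∀ μ : Measure Config, IsBernoulliPercolation pout μ →
        μ (ClusterEvent N (φ N)) ≤
          min (ENNReal.ofReal (α N))
            (ENNReal.ofReal (Real.exp (-C₂ * (φ N : ℝ)))) := by
  obtain ⟨S, hS, hS1⟩ := exists_bexp_exitSites_lt_one h0.le h1
  obtain ⟨z, hz, m, hm1, hm⟩ := exists_exponential_moment h0.le (by linarith) hS hS1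
  have ha : 0 < Real.log z := Real.log_pos hz
  set a := Real.log z with ha'
  have hlog : Filter.Tendsto (fun N : ℕ => Real.log N) Filter.atTop Filter.atTop :=
    Real.tendsto_log_atTop.comp tendsto_natCast_atTop_atTop
  have hev := ((hφ.eventually_ge_atTop (8 / a + (1 + 4 * Real.log m / a))).and
    (hlog.eventually_ge_atTop 1)).and
    ((hαφ.eventually (gt_mem_nhds (half_pos ha))).and (Filter.eventually_ge_atTop 1))
  obtain ⟨N₀, hN₀⟩ := Filter.eventually_atTop.1 hev
  refine ⟨a / 2, half_pos ha, N₀, fun N hN μ hμ => ?_⟩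
  obtain ⟨⟨hratio, hlogN⟩, hα', hN1⟩ := hN₀ N hN
  have hlm : 0 ≤ Real.log m := Real.log_nonneg hm1
  have hlm' : 0 ≤ 4 * Real.log m / a := by positivity
  rw [le_div_iff₀ (by linarith)] at hratio
  have h2 : 8 / a * Real.log N + (1 + 4 * Real.log m / a) ≤ φ N := by nlinarith
  have h3 : 0 ≤ 8 / a * Real.log N := by positivity
  have hφpos : (0 : ℝ) < φ N := by linarith
  have h4 : 8 * Real.log N ≤ a * φ N := by
    have : a * (8 / a * Real.log N) ≤ a * φ N := mul_le_mul_of_nonneg_left (by linarith) ha.le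
    rwa [← mul_assoc, mul_div_cancel₀ _ ha.ne'] at this
  have h5 : 4 * Real.log m ≤ a * φ N := by
    have : a * (4 * Real.log m / a) ≤ a * φ N := mul_le_mul_of_nonneg_left (by linarith) ha.le
    rwa [mul_div_cancel₀ _ ha.ne'] at this
  have hN0 : (0 : ℝ) < N := by exact_mod_cast hN1
  have hm0 : 0 < m := by linarith
  have hz0 : 0 < z := by linarith
  have hbound : (N : ℝ) ^ 2 * m / z ^ φ N ≤ Real.exp (-(a / 2) * φ N) := by
    rw [← Real.log_le_iff_le_exp (by positivity), Real.log_div (by positivity) (by positivity),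
      Real.log_mul (by positivity) hm0.ne', Real.log_pow, Real.log_pow, ← ha']
    push_cast
    linarith
  refine (measure_clusterEvent_le h0.le (by linarith) hz hm hμ N
    (by exact_mod_cast hφpos)).trans (le_min ?_ ?_)
  · refine ENNReal.ofReal_le_ofReal (hbound.trans ?_)
    rw [div_lt_iff₀ hφpos, one_div, Real.log_inv] at hα'
    rw [← Real.le_log_iff_exp_le (hα N).1]
    linarith
  · exact ENNReal.ofReal_le_ofReal hbound
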